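/- arXiv:2108.03812 — 2 statements merged into one kernel-verified Lean document; each statement's English description precedes it below -/
import Mathlib

section
/- Suppose that for every m0 ∈ ℝ and every ω ∈ [0,1] with V_{β,m0}(ω;u=1) ≤ V_{β,m0}(ω;u=0), the right derivative at m0 of the map m ↦ V_{β,m}(ω;u=0) is greater than or equal to the right derivative at m0 of the map m ↦ V_{β,m}(ω;u=1) (both right derivatives exist since these maps are convex in m). Then the single-armed bandit is indexable: for all m ≤ m' and every ω ∈ [0,1], V_{β,m}(ω;u=1) ≤ V_{β,m}(ω;u=0) implies V_{β,m'}(ω;u=1) ≤ V_{β,m'}(ω;u=0). -/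
/-- One-step belief update without observation: `T(ω) = ω·p11 + (1−ω)·p01`. -/
noncomputable def Tmap (p01 p11 ω : ℝ) : ℝ := ω * p11 + (1 - ω) * p01

/-- Belief update after a failed observation: `φ(ω) = εω/(εω + 1 − ω)`. -/
noncomputable def phi (ε ω : ℝ) : ℝ := ε * ω / (ε * ω + 1 - ω)

/-- Active-branch of the Bellman operator: the expected total discounted reward
of activating now and continuing with value function `f`. -/
noncomputable def actV (p01 p11 ε β : ℝ) (f : ℝ → ℝ) (ω : ℝ) : ℝ :=
  (1 - ε) * ω + β * ((1 - ε) * ω * f p11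
    + (1 - (1 - ε) * ω) * f (Tmap p01 p11 (phi ε ω)))

/-- Passive-branch of the Bellman operator: subsidy `m` plus discounted
continuation with value function `f`. -/
noncomputable def pasV (p01 p11 β m : ℝ) (f : ℝ → ℝ) (ω : ℝ) : ℝ :=
  m + β * f (Tmap p01 p11 ω)

/-- The Bellman operator `B` of the single-armed bandit with subsidy `m`. -/
noncomputable def Bop (p01 p11 ε β m : ℝ) (f : ℝ → ℝ) (ω : ℝ) : ℝ :=
  max (actV p01 p11 ε β f ω) (pasV p01 p11 β m f ω)

/-! ### The belief maps -/

section Maps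

variable {p01 p11 ε β : ℝ}

/-- The belief with weight `n` on the good state and weight `d` on the bad state. -/
noncomputable def odds (n d : ℝ) : ℝ := n / (n + d)

lemma odds_self (x : ℝ) : odds x (1 - x) = x := by
  simp [odds]

lemma phi_odds {n d : ℝ} (h : 0 < n + d) (h' : 0 < ε * n + d) :
    phi ε (odds n d) = odds (ε * n) d := by
  have h1 : ε * (n / (n + d)) + 1 - n / (n + d) = (ε * n + d) / (n + d) := by
    field_simp; ring
  unfold phi odds
  rw [h1]
  field_simp

lemma Tmap_odds {n d : ℝ} (h : 0 < n + d) :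
    Tmap p01 p11 (odds n d)
      = odds (p11 * n + p01 * d) ((1 - p11) * n + (1 - p01) * d) := by
  have h1 : p11 * n + p01 * d + ((1 - p11) * n + (1 - p01) * d) = n + d := by ring
  unfold Tmap odds
  rw [h1]
  field_simp
  ring

lemma odds_lt_odds {n d n' d' : ℝ} (h : 0 < n + d) (h' : 0 < n' + d')
    (hlt : n * d' < n' * d) : odds n d < odds n' d' := by
  unfold odds
  rw [div_lt_div_iff₀ h h']
  linarith

lemma odds_le_odds {n d n' d' : ℝ} (h : 0 < n + d) (h' : 0 < n' + d')
    (hle : n * d' ≤ n' * d) : odds n d ≤ odds n' d' := by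
  unfold odds
  rw [div_le_div_iff₀ h h']
  linarith

lemma phi_den_pos (hε : ε ∈ Set.Ioo (0:ℝ) 1) {x : ℝ} (hx : x ∈ Set.Icc (0:ℝ) 1) :
    0 < ε * x + 1 - x := by
  obtain ⟨h0, h1⟩ := hε
  obtain ⟨hx0, hx1⟩ := hx
  nlinarith

lemma phi_mem (hε : ε ∈ Set.Ioo (0:ℝ) 1) {x : ℝ} (hx : x ∈ Set.Icc (0:ℝ) 1) :
    phi ε x ∈ Set.Icc (0:ℝ) 1 := by
  have hd := phi_den_pos hε hx
  refine ⟨div_nonneg (mul_nonneg hε.1.le hx.1) hd.le, ?_⟩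
  rw [phi, div_le_one hd]
  linarith [hx.2]

lemma phi_le_self (hε : ε ∈ Set.Ioo (0:ℝ) 1) {x : ℝ} (hx : x ∈ Set.Icc (0:ℝ) 1) :
    phi ε x ≤ x := by
  have hd := phi_den_pos hε hx
  rw [phi, div_le_iff₀ hd]
  nlinarith [mul_nonneg hx.1 (sub_nonneg.2 hx.2), hε.2]

lemma phi_le_phi (hε : ε ∈ Set.Ioo (0:ℝ) 1) {x y : ℝ} (hx : x ∈ Set.Icc (0:ℝ) 1)
    (hy : y ∈ Set.Icc (0:ℝ) 1) (hxy : x ≤ y) : phi ε x ≤ phi ε y := by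
  rw [phi, phi, div_le_div_iff₀ (phi_den_pos hε hx) (phi_den_pos hε hy)]
  nlinarith [hε.1]

lemma phi_mul_den (hε : ε ∈ Set.Ioo (0:ℝ) 1) {x : ℝ} (hx : x ∈ Set.Icc (0:ℝ) 1) :
    (1 - (1 - ε) * x) * phi ε x = ε * x := by
  have hd := phi_den_pos hε hx
  have : 1 - (1 - ε) * x = ε * x + 1 - x := by ring
  rw [this, phi, mul_div_cancel₀ _ hd.ne']

lemma continuousAt_phi (hε : ε ∈ Set.Ioo (0:ℝ) 1) {x : ℝ} (hx : x ∈ Set.Icc (0:ℝ) 1) :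
    ContinuousAt (phi ε) x := by
  unfold phi
  exact ContinuousAt.div (by fun_prop) (by fun_prop) (phi_den_pos hε hx).ne'

lemma continuous_Tmap : Continuous (Tmap p01 p11) := by
  unfold Tmap
  fun_prop

lemma Tmap_mem_Ioo (hp01 : p01 ∈ Set.Ioo (0:ℝ) 1) (hp11 : p11 ∈ Set.Ioo (0:ℝ) 1) {x : ℝ}
    (hx : x ∈ Set.Icc (0:ℝ) 1) : Tmap p01 p11 x ∈ Set.Ioo (0:ℝ) 1 := by
  obtain ⟨a0, a1⟩ := hp01
  obtain ⟨b0, b1⟩ := hp11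
  obtain ⟨x0, x1⟩ := hx
  unfold Tmap
  constructor
  · rcases eq_or_lt_of_le x0 with h | h
    · subst h; simpa using a0
    · nlinarith [mul_pos h b0, mul_nonneg (sub_nonneg.2 x1) a0.le]
  · rcases eq_or_lt_of_le x0 with h | h
    · subst h; simpa using a1
    · nlinarith [mul_pos h (sub_pos.2 b1), mul_nonneg (sub_nonneg.2 x1) (sub_pos.2 a1).le]

lemma Tmap_mem (hp01 : p01 ∈ Set.Ioo (0:ℝ) 1) (hp11 : p11 ∈ Set.Ioo (0:ℝ) 1) {x : ℝ}
    (hx : x ∈ Set.Icc (0:ℝ) 1) : Tmap p01 p11 x ∈ Set.Icc (0:ℝ) 1 :=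
  Set.Ioo_subset_Icc_self (Tmap_mem_Ioo hp01 hp11 hx)

lemma Tmap_le_Tmap_of_pos (h : p01 ≤ p11) {x y : ℝ} (hxy : x ≤ y) :
    Tmap p01 p11 x ≤ Tmap p01 p11 y := by
  unfold Tmap
  nlinarith

lemma Tmap_le_Tmap_of_neg (h : p11 ≤ p01) {x y : ℝ} (hxy : x ≤ y) :
    Tmap p01 p11 y ≤ Tmap p01 p11 x := by
  unfold Tmap
  nlinarith

lemma Tmap_zero : Tmap p01 p11 0 = p01 := by simp [Tmap]

lemma phi_zero : phi ε 0 = 0 := by simp [phi]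

/-- Averaging the posterior beliefs over the outcome of an observation. -/
lemma Tmap_eq_average (hε : ε ∈ Set.Ioo (0:ℝ) 1) {x : ℝ} (hx : x ∈ Set.Icc (0:ℝ) 1) :
    Tmap p01 p11 x = (1 - ε) * x * p11 + (1 - (1 - ε) * x) * Tmap p01 p11 (phi ε x) := by
  have h := phi_mul_den hε hx
  unfold Tmap
  linear_combination (p01 - p11) * h

lemma linear_pos {u v x : ℝ} (hu : 0 < u) (hv : 0 < v) (hx : x ∈ Set.Icc (0:ℝ) 1) :
    0 < u * x + v * (1 - x) := by
  obtain ⟨x0, x1⟩ := hx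
  rcases eq_or_lt_of_le x0 with h | h
  · subst h; simpa using hv
  · nlinarith [mul_pos hu h, mul_nonneg hv.le (sub_nonneg.2 x1)]

/-- A projective map with positive coefficients applied after a failed observation dominates
the failed observation applied after the map. -/
lemma odds_scale_lt (hε : ε ∈ Set.Ioo (0:ℝ) 1) {n1 n0 d1 d0 x : ℝ} (hn1 : 0 < n1) (hn0 : 0 < n0)
    (hd1 : 0 < d1) (hd0 : 0 < d0) (hx : x ∈ Set.Icc (0:ℝ) 1) :
    odds (ε * (n1 * x + n0 * (1 - x))) (d1 * x + d0 * (1 - x))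
      < odds (n1 * (ε * x) + n0 * (1 - x)) (d1 * (ε * x) + d0 * (1 - x)) := by
  have hn := linear_pos hn1 hn0 hx
  have hd := linear_pos hd1 hd0 hx
  have hn' := linear_pos (mul_pos hn1 hε.1) hn0 hx
  have hd' := linear_pos (mul_pos hd1 hε.1) hd0 hx
  have hs := linear_pos (mul_pos (mul_pos hε.1 hn1) hd1) (mul_pos hn0 hd0) hx
  have hεn := mul_pos hε.1 hn
  refine odds_lt_odds (by linarith) (by linarith) ?_
  have key : (n1 * (ε * x) + n0 * (1 - x)) * (d1 * x + d0 * (1 - x))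
      - ε * (n1 * x + n0 * (1 - x)) * (d1 * (ε * x) + d0 * (1 - x))
      = (1 - ε) * (n0 * (1 - x) * (d1 * x + d0 * (1 - x))
        + ε * (n1 * x + n0 * (1 - x)) * (d1 * x)) := by ring
  have : 0 < n0 * (1 - x) * (d1 * x + d0 * (1 - x))
        + ε * (n1 * x + n0 * (1 - x)) * (d1 * x) := by
    rcases eq_or_lt_of_le hx.1 with h | h
    · subst h; simp; positivity
    · have := mul_pos hεn (mul_pos hd1 h)
      have := mul_nonneg (mul_nonneg hn0.le (sub_nonneg.2 hx.2)) hd.le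
      linarith
  nlinarith [mul_pos (sub_pos.2 hε.2) this]

lemma Tmap_eq_odds (x : ℝ) :
    Tmap p01 p11 x
      = odds (p11 * x + p01 * (1 - x)) ((1 - p11) * x + (1 - p01) * (1 - x)) := by
  conv_lhs => rw [← odds_self x]
  exact Tmap_odds (by ring_nf; norm_num)

lemma phi_eq_odds (x : ℝ) :
    phi ε x = odds (ε * x) (1 - x) := by
  unfold phi odds
  ring_nf

lemma Tmap_phi_eq_odds (hε : ε ∈ Set.Ioo (0:ℝ) 1) {x : ℝ} (hx : x ∈ Set.Icc (0:ℝ) 1) :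
    Tmap p01 p11 (phi ε x)
      = odds (p11 * (ε * x) + p01 * (1 - x)) ((1 - p11) * (ε * x) + (1 - p01) * (1 - x)) := by
  rw [phi_eq_odds]
  exact Tmap_odds (by linarith [phi_den_pos hε hx])

lemma phi_Tmap_lt (hp01 : p01 ∈ Set.Ioo (0:ℝ) 1) (hp11 : p11 ∈ Set.Ioo (0:ℝ) 1)
    (hε : ε ∈ Set.Ioo (0:ℝ) 1) {x : ℝ} (hx : x ∈ Set.Icc (0:ℝ) 1) :
    phi ε (Tmap p01 p11 x) < Tmap p01 p11 (phi ε x) := by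
  have hn := linear_pos hp11.1 hp01.1 hx
  have hd := linear_pos (sub_pos.2 hp11.2) (sub_pos.2 hp01.2) hx
  rw [Tmap_phi_eq_odds hε hx, Tmap_eq_odds,
    phi_odds (by linarith) (by linarith [mul_pos hε.1 hn])]
  exact odds_scale_lt hε hp11.1 hp01.1 (sub_pos.2 hp11.2) (sub_pos.2 hp01.2) hx

lemma phi_Tmap_phi_le (hp01 : p01 ∈ Set.Ioo (0:ℝ) 1) (hp11 : p11 ∈ Set.Ioo (0:ℝ) 1)
    (hε : ε ∈ Set.Ioo (0:ℝ) 1) {x : ℝ} (hx : x ∈ Set.Icc (0:ℝ) 1) :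
    phi ε (Tmap p01 p11 (phi ε x)) ≤ Tmap p01 p11 x := by
  have hn := linear_pos hp11.1 hp01.1 hx
  have hd := linear_pos (sub_pos.2 hp11.2) (sub_pos.2 hp01.2) hx
  have hn' := linear_pos (mul_pos hp11.1 hε.1) hp01.1 hx
  have hd' := linear_pos (mul_pos (sub_pos.2 hp11.2) hε.1) (sub_pos.2 hp01.2) hx
  rw [mul_assoc] at hn' hd'
  have hεn' := mul_pos hε.1 hn'
  rw [Tmap_phi_eq_odds hε hx, Tmap_eq_odds, phi_odds (by linarith) (by linarith)]
  refine odds_le_odds (by linarith) (by linarith) ?_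
  have h1 : p11 * (ε * x) + p01 * (1 - x) ≤ p11 * x + p01 * (1 - x) := by
    nlinarith [mul_nonneg hp11.1.le hx.1, hε.2]
  have h2 : ε * ((1 - p11) * x + (1 - p01) * (1 - x))
      ≤ (1 - p11) * (ε * x) + (1 - p01) * (1 - x) := by
    nlinarith [mul_nonneg (sub_pos.2 hp01.2).le (sub_nonneg.2 hx.2), hε.2]
  calc _ = (p11 * (ε * x) + p01 * (1 - x)) * (ε * ((1 - p11) * x + (1 - p01) * (1 - x))) := by ring
    _ ≤ _ := mul_le_mul h1 h2 (mul_pos hε.1 hd).le hn.le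

lemma phi_Tmap_phi_Tmap_lt (hp01 : p01 ∈ Set.Ioo (0:ℝ) 1) (hp11 : p11 ∈ Set.Ioo (0:ℝ) 1)
    (hε : ε ∈ Set.Ioo (0:ℝ) 1) {x : ℝ} (hx : x ∈ Set.Icc (0:ℝ) 1) :
    phi ε (Tmap p01 p11 (phi ε (Tmap p01 p11 x)))
      < Tmap p01 p11 (phi ε (Tmap p01 p11 (phi ε x))) := by
  obtain ⟨a0, a1⟩ := hp01
  obtain ⟨b0, b1⟩ := hp11
  have a1' := sub_pos.2 a1
  have b1' := sub_pos.2 b1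
  have e0 := hε.1
  have hn := linear_pos b0 a0 hx
  have hd := linear_pos b1' a1' hx
  have hn' := linear_pos (mul_pos b0 e0) a0 hx
  have hd' := linear_pos (mul_pos b1' e0) a1' hx
  rw [mul_assoc] at hn' hd'
  have hεn := mul_pos e0 hn
  have hεn' := mul_pos e0 hn'
  have h1 := add_pos (mul_pos b0 hεn) (mul_pos a0 hd)
  have h2 := add_pos (mul_pos b1' hεn) (mul_pos a1' hd)
  have h3 := mul_pos e0 h1
  rw [Tmap_phi_eq_odds hε hx, Tmap_eq_odds x, phi_odds (by linarith) (by linarith),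
    phi_odds (by linarith) (by linarith), Tmap_odds (by linarith), Tmap_odds (by linarith),
    phi_odds (by linarith) (by linarith)]
  have := odds_scale_lt hε (n1 := p11 * (ε * p11) + p01 * (1 - p11))
    (n0 := p11 * (ε * p01) + p01 * (1 - p01))
    (d1 := (1 - p11) * (ε * p11) + (1 - p01) * (1 - p11))
    (d0 := (1 - p11) * (ε * p01) + (1 - p01) * (1 - p01))
    (by positivity) (by positivity) (by positivity) (by positivity) hx
  convert this using 2 <;> ring

end Maps

/-! ### Bounded fixed points of the Bellman operator -/

/-- Standing assumptions on the parameters. -/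
structure Channel (p01 p11 ε β : ℝ) : Prop where
  hp01 : p01 ∈ Set.Ioo (0:ℝ) 1
  hp11 : p11 ∈ Set.Ioo (0:ℝ) 1
  hε : ε ∈ Set.Ioo (0:ℝ) 1
  hβ : β ∈ Set.Ioo (0:ℝ) 1

/-- `v` is a bounded fixed point on `[0,1]` of the Bellman operator with subsidy `m`. -/
structure IsValue (p01 p11 ε β m : ℝ) (v : ℝ → ℝ) : Prop where
  bdd : ∃ C, ∀ x ∈ Set.Icc (0:ℝ) 1, |v x| ≤ C
  fix : ∀ x ∈ Set.Icc (0:ℝ) 1, v x = Bop p01 p11 ε β m v x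

/-- The advantage of passivity over activity. -/
noncomputable def adv (p01 p11 ε β m : ℝ) (f : ℝ → ℝ) (x : ℝ) : ℝ :=
  pasV p01 p11 β m f x - actV p01 p11 ε β f x

lemma le_of_contraction {s : Set ℝ} {g : ℝ → ℝ} {β d C : ℝ} (hβ : β < 1)
    (hC : ∀ x ∈ s, g x ≤ C)
    (h : ∀ M, (∀ x ∈ s, g x ≤ M) → ∀ x ∈ s, g x ≤ β * M + d) :
    ∀ x ∈ s, g x ≤ d / (1 - β) := by
  intro x hx
  have hb : BddAbove (g '' s) := ⟨C, by rintro _ ⟨y, hy, rfl⟩; exact hC y hy⟩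
  have hle : ∀ y ∈ s, g y ≤ sSup (g '' s) := fun y hy => le_csSup hb ⟨y, hy, rfl⟩
  have hM : sSup (g '' s) ≤ β * sSup (g '' s) + d :=
    csSup_le ⟨g x, x, hx, rfl⟩ (by rintro _ ⟨y, hy, rfl⟩; exact h _ hle y hy)
  refine (hle x hx).trans ?_
  rw [le_div_iff₀ (by linarith)]
  linarith

namespace Channel

variable {p01 p11 ε β : ℝ}

lemma T_mem (hc : Channel p01 p11 ε β)
    {x : ℝ} (hx : x ∈ Set.Icc (0:ℝ) 1) : Tmap p01 p11 x ∈ Set.Icc (0:ℝ) 1 :=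
  Tmap_mem hc.hp01 hc.hp11 hx

lemma φ_mem (hc : Channel p01 p11 ε β)
    {x : ℝ} (hx : x ∈ Set.Icc (0:ℝ) 1) : phi ε x ∈ Set.Icc (0:ℝ) 1 :=
  phi_mem hc.hε hx

lemma Tφ_mem (hc : Channel p01 p11 ε β) {x : ℝ} (hx : x ∈ Set.Icc (0:ℝ) 1) :
    Tmap p01 p11 (phi ε x) ∈ Set.Icc (0:ℝ) 1 :=
  hc.T_mem (hc.φ_mem hx)

lemma p11_mem (hc : Channel p01 p11 ε β) : p11 ∈ Set.Icc (0:ℝ) 1 := Set.Ioo_subset_Icc_self hc.hp11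

lemma p01_mem (hc : Channel p01 p11 ε β) : p01 ∈ Set.Icc (0:ℝ) 1 := Set.Ioo_subset_Icc_self hc.hp01

lemma success_nonneg (hc : Channel p01 p11 ε β)
    {x : ℝ} (hx : x ∈ Set.Icc (0:ℝ) 1) : 0 ≤ (1 - ε) * x :=
  mul_nonneg (sub_pos.2 hc.hε.2).le hx.1

lemma success_le_one (hc : Channel p01 p11 ε β)
    {x : ℝ} (hx : x ∈ Set.Icc (0:ℝ) 1) : 0 ≤ 1 - (1 - ε) * x := by
  nlinarith [hx.1, hx.2, hc.hε.1, hc.hε.2]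

lemma pasV_le (hc : Channel p01 p11 ε β)
    {f g : ℝ → ℝ} {M m m' : ℝ} (h : ∀ x ∈ Set.Icc (0:ℝ) 1, f x ≤ g x + M) {x : ℝ}
    (hx : x ∈ Set.Icc (0:ℝ) 1) :
    pasV p01 p11 β m f x ≤ pasV p01 p11 β m' g x + (m - m') + β * M := by
  have := mul_le_mul_of_nonneg_left (h _ (hc.T_mem hx)) hc.hβ.1.le
  unfold pasV
  linarith

lemma actV_le (hc : Channel p01 p11 ε β)
    {f g : ℝ → ℝ} {M : ℝ} (h : ∀ x ∈ Set.Icc (0:ℝ) 1, f x ≤ g x + M) {x : ℝ}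
    (hx : x ∈ Set.Icc (0:ℝ) 1) :
    actV p01 p11 ε β f x ≤ actV p01 p11 ε β g x + β * M := by
  have h1 := mul_le_mul_of_nonneg_left (h _ hc.p11_mem) (hc.success_nonneg hx)
  have h2 := mul_le_mul_of_nonneg_left (h _ (hc.Tφ_mem hx)) (hc.success_le_one hx)
  have := mul_le_mul_of_nonneg_left (add_le_add h1 h2) hc.hβ.1.le
  unfold actV
  linarith

lemma Bop_le (hc : Channel p01 p11 ε β)
    {f g : ℝ → ℝ} {M m m' d : ℝ} (h : ∀ x ∈ Set.Icc (0:ℝ) 1, f x ≤ g x + M)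
    (hd : 0 ≤ d) (hm : m - m' ≤ d) {x : ℝ} (hx : x ∈ Set.Icc (0:ℝ) 1) :
    Bop p01 p11 ε β m f x ≤ Bop p01 p11 ε β m' g x + (β * M + d) := by
  have h1 : actV p01 p11 ε β g x ≤ Bop p01 p11 ε β m' g x := le_max_left _ _
  have h2 : pasV p01 p11 β m' g x ≤ Bop p01 p11 ε β m' g x := le_max_right _ _
  exact max_le (by linarith [hc.actV_le h hx])
    (by linarith [hc.pasV_le (m := m) (m' := m') h hx])

lemma value_sub_le (hc : Channel p01 p11 ε β)
    {m m' d : ℝ} {v v' : ℝ → ℝ} (hv : IsValue p01 p11 ε β m v)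
    (hv' : IsValue p01 p11 ε β m' v') (hd : 0 ≤ d) (hm : m - m' ≤ d) :
    ∀ x ∈ Set.Icc (0:ℝ) 1, v x - v' x ≤ d / (1 - β) := by
  obtain ⟨C, hC⟩ := hv.bdd
  obtain ⟨C', hC'⟩ := hv'.bdd
  refine le_of_contraction (C := C + C') hc.hβ.2
    (fun x hx => by linarith [(abs_le.1 (hC x hx)).2, (abs_le.1 (hC' x hx)).1]) ?_
  intro M hM x hx
  rw [hv.fix x hx, hv'.fix x hx]
  linarith [hc.Bop_le (f := v) (g := v') (M := M) (fun y hy => by linarith [hM y hy]) hd hm hx]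

lemma value_le_value (hc : Channel p01 p11 ε β)
    {m m' : ℝ} {v v' : ℝ → ℝ} (hv : IsValue p01 p11 ε β m v)
    (hv' : IsValue p01 p11 ε β m' v') (hm : m ≤ m') {x : ℝ} (hx : x ∈ Set.Icc (0:ℝ) 1) :
    v x ≤ v' x := by
  have := hc.value_sub_le hv hv' le_rfl (by linarith) x hx
  simp at this
  exact this

lemma value_abs_sub_le (hc : Channel p01 p11 ε β)
    {m m' : ℝ} {v v' : ℝ → ℝ} (hv : IsValue p01 p11 ε β m v)
    (hv' : IsValue p01 p11 ε β m' v') {x : ℝ} (hx : x ∈ Set.Icc (0:ℝ) 1) :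
    |v x - v' x| ≤ |m - m'| / (1 - β) := by
  refine abs_le.2 ⟨?_, hc.value_sub_le hv hv' (abs_nonneg _) (le_abs_self _) x hx⟩
  have := hc.value_sub_le hv' hv (abs_nonneg (m' - m)) (le_abs_self _) x hx
  rw [abs_sub_comm] at this
  linarith

lemma le_value (hc : Channel p01 p11 ε β) {m : ℝ} {v : ℝ → ℝ} (hv : IsValue p01 p11 ε β m v) {x : ℝ}
    (hx : x ∈ Set.Icc (0:ℝ) 1) : m / (1 - β) ≤ v x := by
  obtain ⟨C, hC⟩ := hv.bdd
  have := le_of_contraction (g := fun x => - v x) (d := -m) (C := C) hc.hβ.2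
    (fun x hx => by linarith [(abs_le.1 (hC x hx)).1]) (by
      intro M hM x hx
      have h1 : pasV p01 p11 β m v x ≤ v x := by
        rw [hv.fix x hx]; exact le_max_right _ _
      have h2 := mul_le_mul_of_nonneg_left (hM _ (hc.T_mem hx)) hc.hβ.1.le
      unfold pasV at h1
      linarith) x hx
  rw [neg_div] at this
  linarith

lemma value_le (hc : Channel p01 p11 ε β)
    {m : ℝ} {v : ℝ → ℝ} (hv : IsValue p01 p11 ε β m v) (hm : 1 - ε ≤ m) {x : ℝ}
    (hx : x ∈ Set.Icc (0:ℝ) 1) : v x ≤ m / (1 - β) := by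
  obtain ⟨C, hC⟩ := hv.bdd
  refine le_of_contraction (g := v) (d := m) (C := C) hc.hβ.2
    (fun x hx => by linarith [(abs_le.1 (hC x hx)).2]) ?_ x hx
  intro M hM x hx
  rw [hv.fix x hx]
  have h0 : ∀ y ∈ Set.Icc (0:ℝ) 1, v y ≤ (fun _ => (0:ℝ)) y + M := by simpa using hM
  have h1 := hc.actV_le h0 hx
  have h2 := hc.pasV_le (m := m) (m' := m) h0 hx
  have h3 : (1 - ε) * x ≤ 1 - ε := by nlinarith [hx.2, hc.hε.2]
  simp only [actV, pasV] at h1 h2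
  simp only [Bop, actV, pasV]
  exact max_le (by linarith) (by linarith)

lemma adv_nonneg_of_le (hc : Channel p01 p11 ε β)
    {m : ℝ} {v : ℝ → ℝ} (hv : IsValue p01 p11 ε β m v) (hm : 1 - ε ≤ m)
    {x : ℝ} (hx : x ∈ Set.Icc (0:ℝ) 1) : 0 ≤ adv p01 p11 ε β m v x := by
  have hval : ∀ y ∈ Set.Icc (0:ℝ) 1, v y = m / (1 - β) := fun y hy =>
    le_antisymm (hc.value_le hv hm hy) (hc.le_value hv hy)
  unfold adv pasV actV
  rw [hval _ (hc.T_mem hx), hval _ (hc.Tφ_mem hx), hval _ hc.p11_mem]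
  have h3 : (1 - ε) * x ≤ 1 - ε := by nlinarith [hx.2, hc.hε.2]
  nlinarith

lemma adv_zero (m : ℝ) (f : ℝ → ℝ) : adv p01 p11 ε β m f 0 = m := by
  simp [adv, pasV, actV, phi_zero]

lemma abs_adv_sub_le (hc : Channel p01 p11 ε β) {f g : ℝ → ℝ} {M m m' : ℝ}
    (h : ∀ x ∈ Set.Icc (0:ℝ) 1, |f x - g x| ≤ M) {x : ℝ} (hx : x ∈ Set.Icc (0:ℝ) 1) :
    |adv p01 p11 ε β m f x - adv p01 p11 ε β m' g x| ≤ |m - m'| + 2 * (β * M) := by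
  have h1 : ∀ y ∈ Set.Icc (0:ℝ) 1, f y ≤ g y + M := fun y hy => by
    linarith [(abs_le.1 (h y hy)).2]
  have h2 : ∀ y ∈ Set.Icc (0:ℝ) 1, g y ≤ f y + M := fun y hy => by
    linarith [(abs_le.1 (h y hy)).1]
  have a1 := hc.pasV_le (m := m) (m' := m') h1 hx
  have a2 := hc.pasV_le (m := m') (m' := m) h2 hx
  have a3 := hc.actV_le h1 hx
  have a4 := hc.actV_le h2 hx
  unfold adv
  rw [abs_le]
  constructor
  · linarith [neg_abs_le (m - m')]
  · linarith [le_abs_self (m - m')]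

lemma value_eq_pasV {m : ℝ} {v : ℝ → ℝ} (hv : IsValue p01 p11 ε β m v) {x : ℝ}
    (hx : x ∈ Set.Icc (0:ℝ) 1) (h : 0 ≤ adv p01 p11 ε β m v x) :
    v x = pasV p01 p11 β m v x := by
  rw [hv.fix x hx]
  exact max_eq_right (sub_nonneg.1 h)

lemma value_eq_actV {m : ℝ} {v : ℝ → ℝ} (hv : IsValue p01 p11 ε β m v) {x : ℝ}
    (hx : x ∈ Set.Icc (0:ℝ) 1) (h : adv p01 p11 ε β m v x ≤ 0) :
    v x = actV p01 p11 ε β v x := by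
  rw [hv.fix x hx]
  exact max_eq_left (sub_nonpos.1 h)

end Channel

/-! ### Values of policies under a mismatched belief -/

/-- Passive step for the value `w ζ x` of a system with true belief `ζ`, controlled as if the
belief were `x`. -/
noncomputable def passK (p01 p11 β m : ℝ) (w : ℝ → ℝ → ℝ) (ζ x : ℝ) : ℝ :=
  m + β * w (Tmap p01 p11 ζ) (Tmap p01 p11 x)

/-- Active step for the value `w ζ x` of a system with true belief `ζ`, controlled as if the
belief were `x`. -/
noncomputable def actK (p01 p11 ε β : ℝ) (w : ℝ → ℝ → ℝ) (ζ x : ℝ) : ℝ :=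
  (1 - ε) * ζ * (1 + β * w p11 p11)
    + β * (ε * ζ * w p11 (Tmap p01 p11 (phi ε x)) + (1 - ζ) * w p01 (Tmap p01 p11 (phi ε x)))

open Classical in
/-- One step of value iteration, with the action chosen on the basis of the assumed belief. -/
noncomputable def stepK (p01 p11 ε β m : ℝ) (w : ℝ → ℝ → ℝ) (ζ x : ℝ) : ℝ :=
  if actK p01 p11 ε β w x x ≤ passK p01 p11 β m w x x then passK p01 p11 β m w ζ x
  else actK p01 p11 ε β w ζ x

/-- `w · x` is affine and is a support line at `x` of the diagonal of `w`. -/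
structure IsSupport (w : ℝ → ℝ → ℝ) : Prop where
  affine : ∀ ζ x, w ζ x = w 0 x + ζ * (w 1 x - w 0 x)
  le_diag : ∀ ζ ∈ Set.Icc (0:ℝ) 1, ∀ x ∈ Set.Icc (0:ℝ) 1, w ζ x ≤ w ζ ζ

lemma IsSupport.le_of_le_left {w : ℝ → ℝ → ℝ} (hw : IsSupport w) {ζ a b : ℝ}
    (ha : a ∈ Set.Icc (0:ℝ) 1) (hb : b ∈ Set.Icc (0:ℝ) 1) (hζa : ζ ≤ a) (hab : a ≤ b) :
    w ζ b ≤ w ζ a := by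
  rcases hab.eq_or_lt with rfl | hlt
  · exact le_rfl
  have h1 := hw.le_diag a ha b hb
  have h2 := hw.le_diag b hb a ha
  rw [hw.affine a b, hw.affine a a] at h1
  rw [hw.affine b a, hw.affine b b] at h2
  rw [hw.affine ζ b, hw.affine ζ a]
  nlinarith [mul_nonneg (sub_nonneg.2 (hζa.trans hab)) (sub_nonneg.2 h1),
    mul_nonneg (sub_nonneg.2 hζa) (sub_nonneg.2 h2)]

lemma IsSupport.le_of_le_right {w : ℝ → ℝ → ℝ} (hw : IsSupport w) {ζ a b : ℝ}
    (ha : a ∈ Set.Icc (0:ℝ) 1) (hb : b ∈ Set.Icc (0:ℝ) 1) (hba : b ≤ a) (haζ : a ≤ ζ) :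
    w ζ b ≤ w ζ a := by
  rcases hba.eq_or_lt with rfl | hlt
  · exact le_rfl
  have h1 := hw.le_diag a ha b hb
  have h2 := hw.le_diag b hb a ha
  rw [hw.affine a b, hw.affine a a] at h1
  rw [hw.affine b a, hw.affine b b] at h2
  rw [hw.affine ζ b, hw.affine ζ a]
  nlinarith [mul_nonneg (sub_nonneg.2 (hba.trans haζ)) (sub_nonneg.2 h1),
    mul_nonneg (sub_nonneg.2 haζ) (sub_nonneg.2 h2)]

lemma IsSupport.convexOn_diag {w : ℝ → ℝ → ℝ} (hw : IsSupport w) :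
    ConvexOn ℝ (Set.Icc (0:ℝ) 1) (fun x => w x x) := by
  refine ⟨convex_Icc 0 1, fun x hx y hy s t hs ht hst => ?_⟩
  have hz := convex_Icc (0:ℝ) 1 hx hy hs ht hst
  simp only [smul_eq_mul] at hz ⊢
  have h1 := mul_le_mul_of_nonneg_left (hw.le_diag x hx _ hz) hs
  have h2 := mul_le_mul_of_nonneg_left (hw.le_diag y hy _ hz) ht
  generalize hzz : s * x + t * y = z at *
  have : s * w x z + t * w y z = w z z := by
    rw [hw.affine x z, hw.affine y z, hw.affine z z]
    linear_combination (w 0 z) * hst + (w 1 z - w 0 z) * hzz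
  linarith

namespace Channel

variable {p01 p11 ε β : ℝ}

lemma actK_eq (hc : Channel p01 p11 ε β)
    {w : ℝ → ℝ → ℝ} (hw : IsSupport w) {ζ : ℝ} (hζ : ζ ∈ Set.Icc (0:ℝ) 1) (x : ℝ) :
    actK p01 p11 ε β w ζ x = (1 - ε) * ζ * (1 + β * w p11 p11) + β * ((1 - (1 - ε) * ζ)
      * w (Tmap p01 p11 (phi ε ζ)) (Tmap p01 p11 (phi ε x))) := by
  have h := phi_mul_den hc.hε hζ
  unfold actK
  generalize Tmap p01 p11 (phi ε x) = y
  rw [hw.affine p11 y, hw.affine p01 y, hw.affine (Tmap p01 p11 (phi ε ζ)) y]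
  unfold Tmap
  linear_combination (-β * (p11 - p01) * (w 1 y - w 0 y)) * h

lemma actK_diag (hc : Channel p01 p11 ε β)
    {w : ℝ → ℝ → ℝ} (hw : IsSupport w) {x : ℝ} (hx : x ∈ Set.Icc (0:ℝ) 1) :
    actK p01 p11 ε β w x x = actV p01 p11 ε β (fun y => w y y) x := by
  rw [hc.actK_eq hw hx]
  unfold actV
  ring

lemma stepK_diag (hc : Channel p01 p11 ε β) (m : ℝ) {w : ℝ → ℝ → ℝ} (hw : IsSupport w) {x : ℝ}
    (hx : x ∈ Set.Icc (0:ℝ) 1) :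
    stepK p01 p11 ε β m w x x = Bop p01 p11 ε β m (fun y => w y y) x := by
  have h1 := hc.actK_diag hw hx
  have h2 : passK p01 p11 β m w x x = pasV p01 p11 β m (fun y => w y y) x := rfl
  unfold stepK Bop
  rw [h1, h2]
  split_ifs with h
  · exact (max_eq_right h).symm
  · exact (max_eq_left (not_le.1 h).le).symm

lemma passK_le (hc : Channel p01 p11 ε β) {w : ℝ → ℝ → ℝ} (hw : IsSupport w) (m : ℝ) {ζ x : ℝ}
    (hζ : ζ ∈ Set.Icc (0:ℝ) 1) (hx : x ∈ Set.Icc (0:ℝ) 1) :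
    passK p01 p11 β m w ζ x ≤ passK p01 p11 β m w ζ ζ := by
  have := mul_le_mul_of_nonneg_left (hw.le_diag _ (hc.T_mem hζ) _ (hc.T_mem hx)) hc.hβ.1.le
  unfold passK
  linarith

lemma actK_le (hc : Channel p01 p11 ε β) {w : ℝ → ℝ → ℝ} (hw : IsSupport w) {ζ x : ℝ}
    (hζ : ζ ∈ Set.Icc (0:ℝ) 1) (hx : x ∈ Set.Icc (0:ℝ) 1) :
    actK p01 p11 ε β w ζ x ≤ actK p01 p11 ε β w ζ ζ := by
  have := mul_le_mul_of_nonneg_left (mul_le_mul_of_nonneg_left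
    (hw.le_diag _ (hc.Tφ_mem hζ) _ (hc.Tφ_mem hx)) (hc.success_le_one hζ)) hc.hβ.1.le
  rw [hc.actK_eq hw hζ, hc.actK_eq hw hζ]
  linarith

lemma stepK_of_passive {m : ℝ} {w : ℝ → ℝ → ℝ} {x : ℝ}
    (h : actK p01 p11 ε β w x x ≤ passK p01 p11 β m w x x) (ζ : ℝ) :
    stepK p01 p11 ε β m w ζ x = passK p01 p11 β m w ζ x := if_pos h

lemma stepK_of_active {m : ℝ} {w : ℝ → ℝ → ℝ} {x : ℝ}
    (h : passK p01 p11 β m w x x < actK p01 p11 ε β w x x) (ζ : ℝ) :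
    stepK p01 p11 ε β m w ζ x = actK p01 p11 ε β w ζ x := if_neg (not_le.2 h)

lemma isSupport_stepK (hc : Channel p01 p11 ε β) (m : ℝ) {w : ℝ → ℝ → ℝ} (hw : IsSupport w) :
    IsSupport (stepK p01 p11 ε β m w) := by
  constructor
  · intro ζ x
    rcases le_or_gt (actK p01 p11 ε β w x x) (passK p01 p11 β m w x x) with h | h
    · simp only [stepK_of_passive h]
      unfold passK
      rw [hw.affine (Tmap p01 p11 ζ), hw.affine (Tmap p01 p11 0), hw.affine (Tmap p01 p11 1)]
      unfold Tmap
      ring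
    · simp only [stepK_of_active h]
      unfold actK
      ring
  · intro ζ hζ x hx
    have hd : stepK p01 p11 ε β m w ζ ζ
        = max (actK p01 p11 ε β w ζ ζ) (passK p01 p11 β m w ζ ζ) := by
      rw [hc.stepK_diag m hw hζ, hc.actK_diag hw hζ]
      rfl
    rw [hd]
    rcases le_or_gt (actK p01 p11 ε β w x x) (passK p01 p11 β m w x x) with h | h
    · rw [stepK_of_passive h]
      exact le_max_of_le_right (hc.passK_le hw m hζ hx)
    · rw [stepK_of_active h]
      exact le_max_of_le_left (hc.actK_le hw hζ hx)

/-- If postponing the change of action costs at most the subsidy, then the advantage of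
passivity relative to the belief decreases. -/
lemma adv_cross (hc : Channel p01 p11 ε β)
    {w : ℝ → ℝ → ℝ} (hw : IsSupport w) {m a b : ℝ} (ha : a ∈ Set.Icc (0:ℝ) 1)
    (hb : b ∈ Set.Icc (0:ℝ) 1) (hab : a ≤ b)
    (h : w p01 (Tmap p01 p11 (phi ε a)) - w p01 (Tmap p01 p11 b) ≤ m) :
    (b - a) * (m * (1 - β)) ≤ b * adv p01 p11 ε β m (fun y => w y y) a
      - a * adv p01 p11 ε β m (fun y => w y y) b := by
  have h1 := hw.le_diag _ (hc.T_mem ha) _ (hc.T_mem hb)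
  have h2 := hc.actK_le hw hb ha
  have hDa : adv p01 p11 ε β m (fun y => w y y) a
      = m + β * w (Tmap p01 p11 a) (Tmap p01 p11 a) - actK p01 p11 ε β w a a := by
    rw [hc.actK_diag hw ha]; rfl
  have hDb : adv p01 p11 ε β m (fun y => w y y) b
      = m + β * w (Tmap p01 p11 b) (Tmap p01 p11 b) - actK p01 p11 ε β w b b := by
    rw [hc.actK_diag hw hb]; rfl
  rw [hDa, hDb]
  have h3 := mul_le_mul_of_nonneg_left (mul_le_mul_of_nonneg_left h1 hc.hβ.1.le) hb.1
  have h4 := mul_le_mul_of_nonneg_left h2 ha.1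
  have h5 := mul_le_mul_of_nonneg_left (mul_le_mul_of_nonneg_left h hc.hβ.1.le)
    (sub_nonneg.2 hab)
  have key : b * (β * w (Tmap p01 p11 a) (Tmap p01 p11 b)) - b * actK p01 p11 ε β w a a
      - a * (β * w (Tmap p01 p11 b) (Tmap p01 p11 b)) + a * actK p01 p11 ε β w b a
      = (b - a) * (β * (w p01 (Tmap p01 p11 b) - w p01 (Tmap p01 p11 (phi ε a)))) := by
    unfold actK
    rw [hw.affine (Tmap p01 p11 a) (Tmap p01 p11 b),
      hw.affine (Tmap p01 p11 b) (Tmap p01 p11 b), hw.affine p01 (Tmap p01 p11 b)]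
    simp only [Tmap]
    ring
  nlinarith

end Channel

/-! ### Coupling estimates -/

/-- The cost of acting at `b` one observation later, when the true belief is lower. -/
def LowGap (ε u M : ℝ) (w : ℝ → ℝ → ℝ) : Prop :=
  ∀ ζ ∈ Set.Icc (0:ℝ) 1, ∀ a ∈ Set.Icc (0:ℝ) 1, ∀ b ∈ Set.Icc (0:ℝ) 1,
    ζ ≤ a → a ≤ b → phi ε b ≤ a → phi ε b ≤ u → w ζ a - w ζ b ≤ M

/-- The mirror image of `LowGap` for a true belief that is higher. -/
def HighGap (p01 p11 ε u M : ℝ) (w : ℝ → ℝ → ℝ) : Prop :=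
  ∀ ζ ∈ Set.Icc (0:ℝ) 1, ∀ a ∈ Set.Icc (0:ℝ) 1, ∀ b ∈ Set.Icc (0:ℝ) 1,
    a ≤ ζ → b ≤ a → u ≤ b →
    phi ε (Tmap p01 p11 (phi ε b)) ≤ Tmap p01 p11 (phi ε a) → w ζ a - w ζ b ≤ M

namespace Channel

variable {p01 p11 ε β : ℝ}

lemma passK_sub_le (hc : Channel p01 p11 ε β)
    {w : ℝ → ℝ → ℝ} {m M ζ a b : ℝ} (hM : 0 ≤ M) (hm : M ≤ m)
    (h : w (Tmap p01 p11 ζ) (Tmap p01 p11 a) - w (Tmap p01 p11 ζ) (Tmap p01 p11 b) ≤ M) :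
    passK p01 p11 β m w ζ a - passK p01 p11 β m w ζ b ≤ m := by
  unfold passK
  nlinarith [hc.hβ.1, hc.hβ.2]

lemma actK_sub_le (hc : Channel p01 p11 ε β) {w : ℝ → ℝ → ℝ} (hw : IsSupport w) {m M ζ a b : ℝ}
    (hζ : ζ ∈ Set.Icc (0:ℝ) 1) (hM : 0 ≤ M) (hm : M ≤ m)
    (h : w (Tmap p01 p11 (phi ε ζ)) (Tmap p01 p11 (phi ε a))
      - w (Tmap p01 p11 (phi ε ζ)) (Tmap p01 p11 (phi ε b)) ≤ M) :
    actK p01 p11 ε β w ζ a - actK p01 p11 ε β w ζ b ≤ m := by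
  rw [hc.actK_eq hw hζ, hc.actK_eq hw hζ]
  have h1 := hc.success_nonneg hζ
  have h2 := hc.success_le_one hζ
  have h3 := mul_le_mul_of_nonneg_left (mul_le_mul_of_nonneg_left h h2) hc.hβ.1.le
  have h4 : β * ((1 - (1 - ε) * ζ) * M) ≤ 1 * (1 * M) := by
    have := hc.hβ.1
    have := hc.hβ.2
    gcongr
    linarith
  linarith

lemma passK_sub_actK_le (hc : Channel p01 p11 ε β) {w : ℝ → ℝ → ℝ} (hw : IsSupport w) {m ζ a b : ℝ}
    (hζ : ζ ∈ Set.Icc (0:ℝ) 1)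
    (h1 : w p11 (Tmap p01 p11 a) ≤ w p11 p11)
    (h2 : w (Tmap p01 p11 (phi ε ζ)) (Tmap p01 p11 a)
      ≤ w (Tmap p01 p11 (phi ε ζ)) (Tmap p01 p11 (phi ε b))) :
    passK p01 p11 β m w ζ a - actK p01 p11 ε β w ζ b ≤ m := by
  rw [hc.actK_eq hw hζ]
  have q0 := hc.success_nonneg hζ
  have q1 := hc.success_le_one hζ
  have e : w (Tmap p01 p11 ζ) (Tmap p01 p11 a) = (1 - ε) * ζ * w p11 (Tmap p01 p11 a)
      + (1 - (1 - ε) * ζ) * w (Tmap p01 p11 (phi ε ζ)) (Tmap p01 p11 a) := by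
    rw [hw.affine (Tmap p01 p11 ζ), hw.affine p11, hw.affine (Tmap p01 p11 (phi ε ζ)),
      Tmap_eq_average hc.hε hζ]
    ring
  unfold passK
  rw [e]
  have h3 := mul_le_mul_of_nonneg_left
    (add_le_add (mul_le_mul_of_nonneg_left h1 q0) (mul_le_mul_of_nonneg_left h2 q1)) hc.hβ.1.le
  linarith

lemma actK_le_passK (hc : Channel p01 p11 ε β)
    {w : ℝ → ℝ → ℝ} (hw : IsSupport w) {m M ζ b : ℝ} (hζ0 : 0 ≤ ζ)
    (hζ : ζ ≤ b) (hM : 0 ≤ M) (hm : M ≤ m)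
    (hb : actK p01 p11 ε β w b b ≤ passK p01 p11 β m w b b)
    (h : w p01 (Tmap p01 p11 (phi ε b)) - w p01 (Tmap p01 p11 b) ≤ M) :
    actK p01 p11 ε β w ζ b ≤ passK p01 p11 β m w ζ b := by
  rcases hζ.eq_or_lt with rfl | hlt
  · exact hb
  have h0 : 0 ≤ m + β * (w p01 (Tmap p01 p11 b) - w p01 (Tmap p01 p11 (phi ε b))) := by
    nlinarith [hc.hβ.1, hc.hβ.2]
  have e : b * (passK p01 p11 β m w ζ b - actK p01 p11 ε β w ζ b)
      = (b - ζ) * (m + β * (w p01 (Tmap p01 p11 b) - w p01 (Tmap p01 p11 (phi ε b))))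
        + ζ * (passK p01 p11 β m w b b - actK p01 p11 ε β w b b) := by
    unfold passK actK
    rw [hw.affine (Tmap p01 p11 ζ) (Tmap p01 p11 b),
      hw.affine (Tmap p01 p11 b) (Tmap p01 p11 b), hw.affine p01 (Tmap p01 p11 b)]
    simp only [Tmap]
    ring
  have h1 := mul_nonneg (sub_nonneg.2 hζ) h0
  have h2 := mul_nonneg hζ0 (sub_nonneg.2 hb)
  have h3 : 0 < b := hζ0.trans_lt hlt
  have : 0 ≤ passK p01 p11 β m w ζ b - actK p01 p11 ε β w ζ b :=
    nonneg_of_mul_nonneg_right (by linarith) h3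
  linarith

/-- The four cases of the coupling argument. -/
lemma stepK_sub_le (hc : Channel p01 p11 ε β) {w : ℝ → ℝ → ℝ} (hw : IsSupport w) {m M ζ a b : ℝ}
    (hζ : ζ ∈ Set.Icc (0:ℝ) 1) (hζb : ζ ≤ b) (hM : 0 ≤ M) (hm : M ≤ m)
    (hpp : actK p01 p11 ε β w b b ≤ passK p01 p11 β m w b b →
      w (Tmap p01 p11 ζ) (Tmap p01 p11 a) - w (Tmap p01 p11 ζ) (Tmap p01 p11 b) ≤ M)
    (haa : w (Tmap p01 p11 (phi ε ζ)) (Tmap p01 p11 (phi ε a))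
      - w (Tmap p01 p11 (phi ε ζ)) (Tmap p01 p11 (phi ε b)) ≤ M)
    (hpa1 : w p11 (Tmap p01 p11 a) ≤ w p11 p11)
    (hpa2 : w (Tmap p01 p11 (phi ε ζ)) (Tmap p01 p11 a)
      ≤ w (Tmap p01 p11 (phi ε ζ)) (Tmap p01 p11 (phi ε b)))
    (hap : actK p01 p11 ε β w b b ≤ passK p01 p11 β m w b b →
      w p01 (Tmap p01 p11 (phi ε b)) - w p01 (Tmap p01 p11 b) ≤ M) :
    stepK p01 p11 ε β m w ζ a - stepK p01 p11 ε β m w ζ b ≤ m := by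
  rcases le_or_gt (actK p01 p11 ε β w a a) (passK p01 p11 β m w a a) with ha | ha <;>
  rcases le_or_gt (actK p01 p11 ε β w b b) (passK p01 p11 β m w b b) with hb | hb
  · rw [stepK_of_passive ha, stepK_of_passive hb]
    exact hc.passK_sub_le hM hm (hpp hb)
  · rw [stepK_of_passive ha, stepK_of_active hb]
    exact hc.passK_sub_actK_le hw hζ hpa1 hpa2
  · rw [stepK_of_active ha, stepK_of_passive hb]
    linarith [hc.actK_sub_le hw hζ hM hm haa, hc.actK_le_passK hw hζ.1 hζb hM hm hb (hap hb)]
  · rw [stepK_of_active ha, stepK_of_active hb]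
    exact hc.actK_sub_le hw hζ hM hm haa

lemma lowGap_stepK_of_pos (hc : Channel p01 p11 ε β)
    (hp : p01 ≤ p11) {w : ℝ → ℝ → ℝ} (hw : IsSupport w) {m M : ℝ}
    (hM : 0 ≤ M) (hm : M ≤ m) (h : LowGap ε 1 M w) :
    LowGap ε 1 m (stepK p01 p11 ε β m w) := by
  intro ζ hζ a ha b hb hζa hab hφ _
  have T_mono : ∀ {x y : ℝ}, x ≤ y → Tmap p01 p11 x ≤ Tmap p01 p11 y :=
    Tmap_le_Tmap_of_pos hp
  have φζa := phi_le_phi hc.hε hζ ha hζa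
  have φab := phi_le_phi hc.hε ha hb hab
  refine hc.stepK_sub_le hw hζ (hζa.trans hab) hM hm (fun _ => ?_) ?_ ?_ ?_ (fun _ => ?_)
  · exact h _ (hc.T_mem hζ) _ (hc.T_mem ha) _ (hc.T_mem hb) (T_mono hζa) (T_mono hab)
      ((phi_Tmap_lt hc.hp01 hc.hp11 hc.hε hb).le.trans (T_mono hφ)) (hc.φ_mem (hc.T_mem hb)).2
  · exact h _ (hc.Tφ_mem hζ) _ (hc.Tφ_mem ha) _ (hc.Tφ_mem hb) (T_mono φζa) (T_mono φab)
      ((phi_Tmap_lt hc.hp01 hc.hp11 hc.hε (hc.φ_mem hb)).le.trans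
        (T_mono (phi_le_phi hc.hε (hc.φ_mem hb) ha hφ))) (hc.φ_mem (hc.Tφ_mem hb)).2
  · exact hw.le_diag _ hc.p11_mem _ (hc.T_mem ha)
  · exact hw.le_of_le_left (hc.Tφ_mem hb) (hc.T_mem ha)
      (T_mono (φζa.trans φab)) (T_mono hφ)
  · refine h _ hc.p01_mem _ (hc.Tφ_mem hb) _ (hc.T_mem hb) ?_ (T_mono (phi_le_self hc.hε hb))
      (phi_Tmap_lt hc.hp01 hc.hp11 hc.hε hb).le (hc.φ_mem (hc.T_mem hb)).2
    have := T_mono (hc.φ_mem hb).1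
    rwa [Tmap_zero] at this

lemma gap_stepK_of_neg (hc : Channel p01 p11 ε β) (hp : p11 ≤ p01) {u : ℝ} (hu : Tmap p01 p11 u = u)
    {w : ℝ → ℝ → ℝ} (hw : IsSupport w) {m M : ℝ} (hM : 0 ≤ M) (hm : M ≤ m)
    (hact : ∀ x ∈ Set.Icc u 1, passK p01 p11 β m w x x < actK p01 p11 ε β w x x)
    (hl : LowGap ε u M w) (hh : HighGap p01 p11 ε u M w) :
    LowGap ε u m (stepK p01 p11 ε β m w) ∧ HighGap p01 p11 ε u m (stepK p01 p11 ε β m w) := by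
  have T_anti : ∀ {x y : ℝ}, x ≤ y → Tmap p01 p11 y ≤ Tmap p01 p11 x :=
    Tmap_le_Tmap_of_neg hp
  constructor
  · intro ζ hζ a ha b hb hζa hab hφ hφu
    have φζa := phi_le_phi hc.hε hζ ha hζa
    have φab := phi_le_phi hc.hε ha hb hab
    have b_lt : actK p01 p11 ε β w b b ≤ passK p01 p11 β m w b b → b ≤ u := by
      intro h
      by_contra hbu
      exact absurd (hact b ⟨(not_le.1 hbu).le, hb.2⟩) (not_lt.2 h)
    have TφTφ_mono : ∀ {x y : ℝ}, x ∈ Set.Icc (0:ℝ) 1 → y ∈ Set.Icc (0:ℝ) 1 → x ≤ y →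
        Tmap p01 p11 (phi ε (Tmap p01 p11 x)) ≤ Tmap p01 p11 (phi ε (Tmap p01 p11 y)) :=
      fun hx hy hxy => T_anti (phi_le_phi hc.hε (hc.T_mem hy) (hc.T_mem hx) (T_anti hxy))
    refine hc.stepK_sub_le hw hζ (hζa.trans hab) hM hm (fun h => ?_) ?_ ?_ ?_ (fun h => ?_)
    · refine hh _ (hc.T_mem hζ) _ (hc.T_mem ha) _ (hc.T_mem hb) (T_anti hζa) (T_anti hab) ?_ ?_
      · have := T_anti (b_lt h)
        rwa [hu] at this
      · exact (phi_Tmap_phi_Tmap_lt hc.hp01 hc.hp11 hc.hε hb).le.trans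
          (TφTφ_mono (hc.φ_mem hb) ha hφ)
    · refine hh _ (hc.Tφ_mem hζ) _ (hc.Tφ_mem ha) _ (hc.Tφ_mem hb) (T_anti φζa) (T_anti φab)
        ?_ ?_
      · have := T_anti hφu
        rwa [hu] at this
      · exact (phi_Tmap_phi_Tmap_lt hc.hp01 hc.hp11 hc.hε (hc.φ_mem hb)).le.trans
          (TφTφ_mono (hc.φ_mem (hc.φ_mem hb)) (hc.φ_mem ha)
            (phi_le_phi hc.hε (hc.φ_mem hb) ha hφ))
    · exact hw.le_diag _ hc.p11_mem _ (hc.T_mem ha)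
    · exact hw.le_of_le_right (hc.Tφ_mem hb) (hc.T_mem ha)
        (T_anti hφ) (T_anti (φζa.trans φab))
    · refine hh _ hc.p01_mem _ (hc.Tφ_mem hb) _ (hc.T_mem hb) ?_
        (T_anti (phi_le_self hc.hε hb)) ?_ ?_
      · have := T_anti (hc.φ_mem hb).1
        rwa [Tmap_zero] at this
      · have := T_anti (b_lt h)
        rwa [hu] at this
      · exact (phi_Tmap_phi_Tmap_lt hc.hp01 hc.hp11 hc.hε hb).le
  · intro ζ hζ a ha b hb haζ hba hub hφ
    have φζa := phi_le_phi hc.hε ha hζ haζ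
    have φab := phi_le_phi hc.hε hb ha hba
    rw [stepK_of_active (hact a ⟨hub.trans hba, ha.2⟩), stepK_of_active (hact b ⟨hub, hb.2⟩)]
    refine hc.actK_sub_le hw hζ hM hm ?_
    refine hl _ (hc.Tφ_mem hζ) _ (hc.Tφ_mem ha) _ (hc.Tφ_mem hb) (T_anti φζa) (T_anti φab)
      hφ ?_
    have := T_anti hub
    rw [hu] at this
    exact (phi_Tmap_phi_le hc.hp01 hc.hp11 hc.hε hb).trans this

end Channel

/-! ### Value iteration with a varying subsidy -/

/-- Value iteration along the subsidies `s`, started from the value of constant activity. -/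
noncomputable def iterK (p01 p11 ε β : ℝ) (s : ℕ → ℝ) : ℕ → ℝ → ℝ → ℝ
  | 0 => fun ζ _ => (1 - ε) / (1 - β * (p11 - p01)) * ζ
      + β * ((1 - ε) / (1 - β * (p11 - p01))) * p01 / (1 - β)
  | n + 1 => stepK p01 p11 ε β (s n) (iterK p01 p11 ε β s n)

namespace Channel

variable {p01 p11 ε β : ℝ}

lemma isSupport_iterK (hc : Channel p01 p11 ε β)
    (s : ℕ → ℝ) (n : ℕ) : IsSupport (iterK p01 p11 ε β s n) := by
  induction n with
  | zero => exact ⟨fun ζ x => by simp only [iterK]; ring, fun ζ _ x _ => le_rfl⟩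
  | succ n ih => exact hc.isSupport_stepK (s n) ih

lemma isValue_iterK_zero (hc : Channel p01 p11 ε β) (s : ℕ → ℝ) :
    IsValue p01 p11 ε β 0 (fun x => iterK p01 p11 ε β s 0 x x) := by
  have h1 : 0 < 1 - β := sub_pos.2 hc.hβ.2
  have h2 : 0 < 1 - β * (p11 - p01) := by
    nlinarith [hc.hβ.1, hc.hβ.2, hc.hp01.1, hc.hp01.2, hc.hp11.1, hc.hp11.2]
  simp only [iterK]
  generalize ha : (1 - ε) / (1 - β * (p11 - p01)) = a
  generalize hk : β * a * p01 / (1 - β) = k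
  rw [div_eq_iff h2.ne'] at ha
  rw [div_eq_iff h1.ne'] at hk
  constructor
  · refine ⟨|a| + |k|, fun x hx => (abs_add_le _ _).trans ?_⟩
    rw [abs_mul, abs_of_nonneg hx.1]
    nlinarith [abs_nonneg a, hx.2]
  · intro x hx
    have hact : a * x + k = actV p01 p11 ε β (fun x => a * x + k) x := by
      have h := Tmap_eq_average (p01 := p01) (p11 := p11) hc.hε hx
      have h' : Tmap p01 p11 x = x * p11 + (1 - x) * p01 := rfl
      unfold actV
      linear_combination -hk + x * (-ha) - β * a * h' + β * a * h
    rw [hact, Bop, eq_comm]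
    refine max_eq_left ?_
    have h := Tmap_eq_average (p01 := p01) (p11 := p11) hc.hε hx
    have h' := hc.success_nonneg hx
    unfold pasV actV
    rw [h]
    linarith

lemma abs_Bop_sub_le (hc : Channel p01 p11 ε β) (m : ℝ) {f g : ℝ → ℝ} {M : ℝ}
    (h : ∀ x ∈ Set.Icc (0:ℝ) 1, |f x - g x| ≤ M) {x : ℝ} (hx : x ∈ Set.Icc (0:ℝ) 1) :
    |Bop p01 p11 ε β m f x - Bop p01 p11 ε β m g x| ≤ β * M := by
  have h1 := hc.Bop_le (f := f) (g := g) (m := m) (m' := m) (d := 0)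
    (fun y hy => by linarith [(abs_le.1 (h y hy)).2]) le_rfl (by linarith) hx
  have h2 := hc.Bop_le (f := g) (g := f) (m := m) (m' := m) (d := 0)
    (fun y hy => by linarith [(abs_le.1 (h y hy)).1]) le_rfl (by linarith) hx
  exact abs_le.2 ⟨by linarith, by linarith⟩

lemma abs_iterK_succ_sub_le (hc : Channel p01 p11 ε β)
    {V : ℝ → ℝ → ℝ} (hV : ∀ m, IsValue p01 p11 ε β m (V m)) {s : ℕ → ℝ} {n : ℕ} {M : ℝ}
    (h : ∀ x ∈ Set.Icc (0:ℝ) 1, |iterK p01 p11 ε β s n x x - V (s n) x| ≤ M) {x : ℝ}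
    (hx : x ∈ Set.Icc (0:ℝ) 1) :
    |iterK p01 p11 ε β s (n + 1) x x - V (s n) x| ≤ β * M := by
  rw [(hV (s n)).fix x hx, iterK, hc.stepK_diag _ (hc.isSupport_iterK s n) hx]
  exact hc.abs_Bop_sub_le (s n) h hx

lemma abs_iterK_sub_of_abs_sub (hc : Channel p01 p11 ε β)
    {V : ℝ → ℝ → ℝ} (hV : ∀ m, IsValue p01 p11 ε β m (V m)) {s : ℕ → ℝ} {n : ℕ} {M m m' : ℝ}
    (h : ∀ x ∈ Set.Icc (0:ℝ) 1, |iterK p01 p11 ε β s n x x - V m x| ≤ M) {x : ℝ}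
    (hx : x ∈ Set.Icc (0:ℝ) 1) :
    |iterK p01 p11 ε β s n x x - V m' x| ≤ M + |m - m'| / (1 - β) :=
  (abs_sub_le _ (V m x) _).trans (add_le_add (h x hx) (hc.value_abs_sub_le (hV m) (hV m') hx))

lemma iterK_zero_eq (hc : Channel p01 p11 ε β)
    {V : ℝ → ℝ → ℝ} (hV : ∀ m, IsValue p01 p11 ε β m (V m))
    (s : ℕ → ℝ) {x : ℝ} (hx : x ∈ Set.Icc (0:ℝ) 1) :
    iterK p01 p11 ε β s 0 x x = V 0 x :=
  le_antisymm (hc.value_le_value (hc.isValue_iterK_zero s) (hV 0) le_rfl hx)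
    (hc.value_le_value (hV 0) (hc.isValue_iterK_zero s) le_rfl hx)

lemma exists_abs_iterK_sub_le (hc : Channel p01 p11 ε β)
    {V : ℝ → ℝ → ℝ} (hV : ∀ m, IsValue p01 p11 ε β m (V m)) (s : ℕ → ℝ) (n : ℕ) :
    ∃ C, ∀ x ∈ Set.Icc (0:ℝ) 1, |iterK p01 p11 ε β s n x x - V 0 x| ≤ C := by
  induction n with
  | zero => exact ⟨0, fun x hx => by rw [hc.iterK_zero_eq hV s hx, sub_self, abs_zero]⟩
  | succ n ih =>
    obtain ⟨C, hC⟩ := ih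
    exact ⟨_, fun x hx => hc.abs_iterK_sub_of_abs_sub hV (fun y hy =>
      hc.abs_iterK_succ_sub_le hV (fun z hz => hc.abs_iterK_sub_of_abs_sub hV hC hz) hy) hx⟩

lemma exists_iterK_near (hc : Channel p01 p11 ε β)
    {V : ℝ → ℝ → ℝ} (hV : ∀ m, IsValue p01 p11 ε β m (V m))
    {s : ℕ → ℝ} {N : ℕ} {m η : ℝ} (hs : ∀ n, N ≤ n → s n = m)
    (hη : 0 < η) :
    ∃ n, N ≤ n ∧ ∀ x ∈ Set.Icc (0:ℝ) 1, |iterK p01 p11 ε β s n x x - V m x| ≤ η := by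
  obtain ⟨C, hC⟩ := hc.exists_abs_iterK_sub_le hV s N
  have hE : ∀ k, ∀ x ∈ Set.Icc (0:ℝ) 1, |iterK p01 p11 ε β s (N + k) x x - V m x|
      ≤ β ^ k * (C + |0 - m| / (1 - β)) := by
    intro k
    induction k with
    | zero =>
      intro x hx
      simpa using hc.abs_iterK_sub_of_abs_sub hV (m' := m) hC hx
    | succ k ih =>
      intro x hx
      have hs' := hs (N + k) (by omega)
      have := hc.abs_iterK_succ_sub_le hV (s := s) (n := N + k) (by rw [hs']; exact ih) hx
      rw [hs'] at this
      rw [pow_succ', mul_assoc]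
      exact this
  have hlim : Filter.Tendsto (fun k : ℕ => β ^ k * (C + |0 - m| / (1 - β))) Filter.atTop
      (nhds (0 * (C + |0 - m| / (1 - β)))) :=
    (tendsto_pow_atTop_nhds_zero_of_lt_one hc.hβ.1.le hc.hβ.2).mul_const _
  rw [zero_mul] at hlim
  obtain ⟨k, hk⟩ := (hlim.eventually (gt_mem_nhds hη)).exists
  exact ⟨N + k, by omega, fun x hx => (hE k x hx).trans hk.le⟩

lemma convexOn_value (hc : Channel p01 p11 ε β)
    {V : ℝ → ℝ → ℝ} (hV : ∀ m, IsValue p01 p11 ε β m (V m))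
    (m : ℝ) : ConvexOn ℝ (Set.Icc (0:ℝ) 1) (V m) := by
  refine ⟨convex_Icc 0 1, fun x hx y hy a b ha hb hab => ?_⟩
  refine le_of_forall_pos_le_add fun η hη => ?_
  obtain ⟨n, -, hn⟩ := hc.exists_iterK_near hV (s := fun _ => m) (N := 0) (fun _ _ => rfl)
    (half_pos hη)
  have hz := convex_Icc (0:ℝ) 1 hx hy ha hb hab
  have h := (hc.isSupport_iterK (fun _ => m) n).convexOn_diag.2 hx hy ha hb hab
  have h1 := abs_le.1 (hn x hx)
  have h2 := abs_le.1 (hn y hy)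
  have h3 := abs_le.1 (hn _ hz)
  simp only [smul_eq_mul] at *
  have h4 := mul_le_mul_of_nonneg_left h1.2 ha
  have h5 := mul_le_mul_of_nonneg_left h2.2 hb
  have h6 : a * (η / 2) + b * (η / 2) = η / 2 := by rw [← add_mul, hab, one_mul]
  linarith

lemma adv_cross_of_near (hc : Channel p01 p11 ε β) {V : ℝ → ℝ → ℝ}
    {P : (ℝ → ℝ → ℝ) → Prop} {m a b : ℝ}
    (hnear : ∀ η > 0, ∃ w, IsSupport w ∧ P w ∧
      ∀ x ∈ Set.Icc (0:ℝ) 1, |w x x - V m x| ≤ η)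
    (ha : a ∈ Set.Icc (0:ℝ) 1) (hb : b ∈ Set.Icc (0:ℝ) 1) (hab : a ≤ b)
    (h : ∀ w, P w → w p01 (Tmap p01 p11 (phi ε a)) - w p01 (Tmap p01 p11 b) ≤ m) :
    (b - a) * (m * (1 - β)) ≤ b * adv p01 p11 ε β m (V m) a
      - a * adv p01 p11 ε β m (V m) b := by
  refine le_of_forall_pos_le_add fun η hη => ?_
  obtain ⟨w, hw, hPw, hn⟩ := hnear (η / 4) (by positivity)
  have h1 := hc.adv_cross hw ha hb hab (h w hPw)
  have h2 := (abs_le.1 (hc.abs_adv_sub_le (m := m) (m' := m) hn ha)).2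
  have h3 := (abs_le.1 (hc.abs_adv_sub_le (m := m) (m' := m) hn hb)).1
  simp only [sub_self, abs_zero, zero_add] at h2 h3
  have h4 : β * (η / 4) ≤ η / 4 := by nlinarith [hc.hβ.2]
  have h5 := mul_le_mul_of_nonneg_left (h2.trans (mul_le_mul_of_nonneg_left h4 zero_le_two)) hb.1
  have h6 := mul_le_mul_of_nonneg_left
    ((neg_le_neg (mul_le_mul_of_nonneg_left h4 zero_le_two)).trans h3) ha.1
  nlinarith [ha.2, hb.2]

lemma adv_cross_of_pos (hc : Channel p01 p11 ε β)
    {V : ℝ → ℝ → ℝ} (hV : ∀ m, IsValue p01 p11 ε β m (V m))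
    (hp : p01 ≤ p11) {m a b : ℝ} (hm : 0 ≤ m) (ha : a ∈ Set.Icc (0:ℝ) 1)
    (hb : b ∈ Set.Icc (0:ℝ) 1) (hab : a ≤ b)
    (h : phi ε (Tmap p01 p11 b) ≤ Tmap p01 p11 (phi ε a)) :
    (b - a) * (m * (1 - β)) ≤ b * adv p01 p11 ε β m (V m) a
      - a * adv p01 p11 ε β m (V m) b := by
  refine hc.adv_cross_of_near (P := LowGap ε 1 m) (fun η hη => ?_) ha hb hab fun w hw => ?_
  · obtain ⟨n, -, hn⟩ := hc.exists_iterK_near hV (s := fun _ => m) (N := 0) (fun _ _ => rfl) hη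
    refine ⟨_, hc.isSupport_iterK _ n, ?_, hn⟩
    clear hn
    induction n with
    | zero =>
      intro ζ _ a _ b _ _ _ _ _
      simpa [iterK] using hm
    | succ n ih => exact hc.lowGap_stepK_of_pos hp (hc.isSupport_iterK _ n) hm le_rfl ih
  · have T_mono : ∀ {x y : ℝ}, x ≤ y → Tmap p01 p11 x ≤ Tmap p01 p11 y :=
      Tmap_le_Tmap_of_pos hp
    refine hw _ hc.p01_mem _ (hc.Tφ_mem ha) _ (hc.T_mem hb) ?_
      (T_mono ((phi_le_self hc.hε ha).trans hab)) h (hc.φ_mem (hc.T_mem hb)).2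
    have := T_mono (hc.φ_mem ha).1
    rwa [Tmap_zero] at this

lemma adv_cross_of_neg (hc : Channel p01 p11 ε β)
    {V : ℝ → ℝ → ℝ} (hV : ∀ m, IsValue p01 p11 ε β m (V m))
    (hp : p11 ≤ p01) {u : ℝ} (hu : Tmap p01 p11 u = u) {m γ : ℝ}
    (hu0 : 0 ≤ u) (hm : 0 ≤ m) (hγ : 0 < γ)
    (hact : ∀ μ ∈ Set.Icc 0 m, ∀ x ∈ Set.Icc u 1, adv p01 p11 ε β μ (V μ) x ≤ -γ)
    {a b : ℝ} (ha : a ∈ Set.Icc (0:ℝ) 1) (hb : b ∈ Set.Icc (0:ℝ) 1) (hab : a ≤ b)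
    (hbu : b ≤ u)
    (h : phi ε (Tmap p01 p11 (phi ε (Tmap p01 p11 b)))
      ≤ Tmap p01 p11 (phi ε (Tmap p01 p11 (phi ε a)))) :
    (b - a) * (m * (1 - β)) ≤ b * adv p01 p11 ε β m (V m) a
      - a * adv p01 p11 ε β m (V m) b := by
  have T_anti : ∀ {x y : ℝ}, x ≤ y → Tmap p01 p11 y ≤ Tmap p01 p11 x :=
    Tmap_le_Tmap_of_neg hp
  refine hc.adv_cross_of_near (P := HighGap p01 p11 ε u m) (fun η hη => ?_) ha hb hab
    fun w hw => ?_
  · have hβ := sub_pos.2 hc.hβ.2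
    obtain ⟨δ, hδ0, hδ⟩ : ∃ δ > 0, 2 * (δ / (1 - β) ^ 2) < γ :=
      ⟨γ * (1 - β) ^ 2 / 4, by positivity, by field_simp; norm_num⟩
    obtain ⟨N, hN⟩ := exists_nat_ge (m / δ)
    rw [div_le_iff₀ hδ0] at hN
    obtain ⟨s, hs⟩ : ∃ s : ℕ → ℝ, s = fun n : ℕ => min (n * δ) m := ⟨_, rfl⟩
    have hsN : ∀ n, N ≤ n → s n = m := fun n hn => by
      rw [hs]
      refine min_eq_right (hN.trans ?_)
      gcongr
    have s_nonneg : ∀ n, 0 ≤ s n := fun n => by rw [hs]; positivity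
    have s_le : ∀ n, s n ≤ m := fun n => by rw [hs]; exact min_le_right _ _
    have s_mono : ∀ n, s n ≤ s (n + 1) := fun n => by
      rw [hs]
      refine min_le_min ?_ le_rfl
      push_cast
      nlinarith
    have s_step : ∀ n, s (n + 1) ≤ s n + δ := fun n => by
      rw [hs]
      push_cast
      rw [← min_add_add_right]
      exact min_le_min (by linarith) (by linarith)
    have hE : ∀ n, ∀ x ∈ Set.Icc (0:ℝ) 1,
        |iterK p01 p11 ε β s n x x - V (s n) x| ≤ δ / (1 - β) ^ 2 := by
      intro n
      induction n with
      | zero =>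
        intro x hx
        have : s 0 = 0 := by rw [hs]; simpa using hm
        rw [this, hc.iterK_zero_eq hV s hx, sub_self, abs_zero]
        positivity
      | succ n ih =>
        intro x hx
        have h1 := hc.abs_iterK_sub_of_abs_sub hV (m' := s (n + 1))
          (fun y hy => hc.abs_iterK_succ_sub_le hV ih hy) hx
        have h2 : |s n - s (n + 1)| / (1 - β) ≤ δ / (1 - β) := by
          gcongr
          rw [abs_le]
          constructor <;> linarith [s_mono n, s_step n]
        have h3 : β * (δ / (1 - β) ^ 2) + δ / (1 - β) = δ / (1 - β) ^ 2 := by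
          field_simp
          ring
        linarith
    have hG : ∀ n, LowGap ε u (s n) (iterK p01 p11 ε β s n)
        ∧ HighGap p01 p11 ε u (s n) (iterK p01 p11 ε β s n) := by
      intro n
      induction n with
      | zero =>
        constructor
        · intro ζ _ a _ b _ _ _ _ _
          simpa [iterK] using s_nonneg 0
        · intro ζ _ a _ b _ _ _ _ _
          simpa [iterK] using s_nonneg 0
      | succ n ih =>
        have hsup := hc.isSupport_iterK s n
        have := hc.gap_stepK_of_neg hp hu hsup (s_nonneg n) le_rfl (fun x hx => ?_) ih.1 ih.2
        · exact ⟨fun ζ hζ a ha b hb h1 h2 h3 h4 =>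
              (this.1 ζ hζ a ha b hb h1 h2 h3 h4).trans (s_mono n),
            fun ζ hζ a ha b hb h1 h2 h3 h4 =>
              (this.2 ζ hζ a ha b hb h1 h2 h3 h4).trans (s_mono n)⟩
        · have hx' : x ∈ Set.Icc (0:ℝ) 1 := ⟨hu0.trans hx.1, hx.2⟩
          have h1 := (abs_le.1 (hc.abs_adv_sub_le (m := s n) (m' := s n) (hE n) hx')).2
          have h2 := hact (s n) ⟨s_nonneg n, s_le n⟩ x hx
          have h3 : β * (δ / (1 - β) ^ 2) ≤ 1 * (δ / (1 - β) ^ 2) := by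
            have := hc.hβ.2
            gcongr
          rw [sub_self, abs_zero, zero_add] at h1
          rw [hc.actK_diag hsup hx']
          have h4 : adv p01 p11 ε β (s n) (fun x => iterK p01 p11 ε β s n x x) x < 0 := by
            linarith
          exact sub_neg.1 h4
    obtain ⟨n, hNn, hn⟩ := hc.exists_iterK_near hV hsN hη
    refine ⟨_, hc.isSupport_iterK _ n, ?_, hn⟩
    rw [← hsN n hNn]
    exact (hG n).2
  · refine hw _ hc.p01_mem _ (hc.Tφ_mem ha) _ (hc.T_mem hb) ?_
      (T_anti ((phi_le_self hc.hε ha).trans hab)) ?_ h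
    · have := T_anti (hc.φ_mem ha).1
      rwa [Tmap_zero] at this
    · have := T_anti hbu
      rwa [hu] at this

end Channel

/-! ### Regularity of the advantage of passivity -/

namespace Channel

variable {p01 p11 ε β : ℝ}

lemma adv_le (hc : Channel p01 p11 ε β)
    {V : ℝ → ℝ → ℝ} (hV : ∀ m, IsValue p01 p11 ε β m (V m))
    (m : ℝ) {x : ℝ} (hx : x ∈ Set.Icc (0:ℝ) 1) :
    adv p01 p11 ε β m (V m) x ≤ m - (1 - ε) * x := by
  have h := (hc.convexOn_value hV m).2 hc.p11_mem (hc.Tφ_mem hx) (hc.success_nonneg hx)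
    (hc.success_le_one hx) (by ring)
  simp only [smul_eq_mul] at h
  rw [← Tmap_eq_average hc.hε hx] at h
  have := mul_le_mul_of_nonneg_left h hc.hβ.1.le
  unfold adv pasV actV
  linarith

lemma continuousOn_adv (hc : Channel p01 p11 ε β)
    {V : ℝ → ℝ → ℝ} (hV : ∀ m, IsValue p01 p11 ε β m (V m)) (m : ℝ) :
    ContinuousOn (adv p01 p11 ε β m (V m)) (Set.Icc (0:ℝ) 1) := by
  have hcv := (hc.convexOn_value hV m).continuousOn_interior
  rw [interior_Icc] at hcv
  have hφ : ContinuousOn (phi ε) (Set.Icc (0:ℝ) 1) := fun x hx =>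
    (continuousAt_phi hc.hε hx).continuousWithinAt
  have h1 : ContinuousOn (fun x => V m (Tmap p01 p11 x)) (Set.Icc (0:ℝ) 1) :=
    hcv.comp continuous_Tmap.continuousOn fun x hx => Tmap_mem_Ioo hc.hp01 hc.hp11 hx
  have h2 : ContinuousOn (fun x => V m (Tmap p01 p11 (phi ε x))) (Set.Icc (0:ℝ) 1) :=
    h1.comp hφ fun x hx => hc.φ_mem hx
  unfold adv pasV actV
  exact ((h1.const_mul β).const_add m).sub ((by fun_prop : Continuous fun x : ℝ =>
    (1 - ε) * x).continuousOn.add ((((by fun_prop : Continuous fun x : ℝ =>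
      (1 - ε) * x * V m p11).continuousOn).add (((by fun_prop : Continuous fun x : ℝ =>
        1 - (1 - ε) * x).continuousOn).mul h2)).const_mul β))

lemma abs_adv_value_sub_le (hc : Channel p01 p11 ε β)
    {V : ℝ → ℝ → ℝ} (hV : ∀ m, IsValue p01 p11 ε β m (V m))
    (m m' : ℝ) {x : ℝ} (hx : x ∈ Set.Icc (0:ℝ) 1) :
    |adv p01 p11 ε β m (V m) x - adv p01 p11 ε β m' (V m') x|
      ≤ (1 + 2 * (β / (1 - β))) * |m - m'| := by
  refine (hc.abs_adv_sub_le (m := m) (m' := m')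
    (fun y hy => hc.value_abs_sub_le (hV m) (hV m') hy) hx).trans (le_of_eq ?_)
  ring

lemma continuous_adv_subsidy (hc : Channel p01 p11 ε β)
    {V : ℝ → ℝ → ℝ} (hV : ∀ m, IsValue p01 p11 ε β m (V m)) {x : ℝ} (hx : x ∈ Set.Icc (0:ℝ) 1) :
    Continuous (fun m => adv p01 p11 ε β m (V m) x) := by
  have hβ := sub_pos.2 hc.hβ.2
  have := hc.hβ.1
  exact (LipschitzWith.of_dist_le_mul (K := ⟨1 + 2 * (β / (1 - β)), by positivity⟩)
    fun m m' => hc.abs_adv_value_sub_le hV m m' hx).continuous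

lemma continuousOn_adv_prod (hc : Channel p01 p11 ε β)
    {V : ℝ → ℝ → ℝ} (hV : ∀ m, IsValue p01 p11 ε β m (V m)) :
    ContinuousOn (fun p : ℝ × ℝ => adv p01 p11 ε β p.1 (V p.1) p.2)
      (Set.univ ×ˢ Set.Icc (0:ℝ) 1) := by
  have hβ := sub_pos.2 hc.hβ.2
  have := hc.hβ.1
  exact continuousOn_prod_of_continuousOn_lipschitzOnWith _
    (⟨1 + 2 * (β / (1 - β)), by positivity⟩)
    (fun m _ => hc.continuousOn_adv hV m)
    (fun x hx => (LipschitzWith.of_dist_le_mul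
      fun m m' => hc.abs_adv_value_sub_le hV m m' hx).lipschitzOnWith)

lemma convexOn_value_subsidy (hc : Channel p01 p11 ε β)
    {V : ℝ → ℝ → ℝ} (hV : ∀ m, IsValue p01 p11 ε β m (V m)) {x : ℝ} (hx : x ∈ Set.Icc (0:ℝ) 1) :
    ConvexOn ℝ Set.univ (fun m => V m x) := by
  refine ⟨convex_univ, fun m _ m' _ a b ha hb hab => ?_⟩
  simp only [smul_eq_mul]
  obtain ⟨C, hC⟩ := (hV m).bdd
  obtain ⟨C', hC'⟩ := (hV m').bdd
  obtain ⟨C'', hC''⟩ := (hV (a * m + b * m')).bdd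
  have := le_of_contraction (s := Set.Icc (0:ℝ) 1) (β := β) (d := 0)
    (g := fun x => V (a * m + b * m') x - (a * V m x + b * V m' x))
    (C := C'' + (a * C + b * C')) hc.hβ.2 (fun y hy => by
      have h1 := mul_le_mul_of_nonneg_left (abs_le.1 (hC y hy)).1 ha
      have h2 := mul_le_mul_of_nonneg_left (abs_le.1 (hC' y hy)).1 hb
      linarith [(abs_le.1 (hC'' y hy)).2]) (by
      intro M hM y hy
      have hM' : ∀ z ∈ Set.Icc (0:ℝ) 1, V (a * m + b * m') z
          ≤ (fun z => a * V m z + b * V m' z) z + M := fun z hz => by linarith [hM z hz]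
      have e1 : actV p01 p11 ε β (fun z => a * V m z + b * V m' z) y
          = a * actV p01 p11 ε β (V m) y + b * actV p01 p11 ε β (V m') y := by
        unfold actV
        linear_combination (-(1 - ε) * y) * hab
      have e2 : pasV p01 p11 β (a * m + b * m') (fun z => a * V m z + b * V m' z) y
          = a * pasV p01 p11 β m (V m) y + b * pasV p01 p11 β m' (V m') y := by
        unfold pasV
        ring
      have h1 : actV p01 p11 ε β (V m) y ≤ V m y := by
        rw [(hV m).fix y hy]; exact le_max_left _ _
      have h2 : actV p01 p11 ε β (V m') y ≤ V m' y := by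
        rw [(hV m').fix y hy]; exact le_max_left _ _
      have h3 : pasV p01 p11 β m (V m) y ≤ V m y := by
        rw [(hV m).fix y hy]; exact le_max_right _ _
      have h4 : pasV p01 p11 β m' (V m') y ≤ V m' y := by
        rw [(hV m').fix y hy]; exact le_max_right _ _
      have h5 := hc.actV_le hM' hy
      have h6 := hc.pasV_le (m := a * m + b * m') (m' := a * m + b * m') hM' hy
      have h7 := mul_le_mul_of_nonneg_left h1 ha
      have h8 := mul_le_mul_of_nonneg_left h2 hb
      have h9 := mul_le_mul_of_nonneg_left h3 ha
      have h10 := mul_le_mul_of_nonneg_left h4 hb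
      have : V (a * m + b * m') y ≤ a * V m y + b * V m' y + β * M := by
        rw [(hV (a * m + b * m')).fix y hy]
        exact max_le (by linarith) (by linarith)
      linarith) x hx
  rw [zero_div] at this
  linarith

lemma convexOn_pasV (hc : Channel p01 p11 ε β)
    {V : ℝ → ℝ → ℝ} (hV : ∀ m, IsValue p01 p11 ε β m (V m)) {x : ℝ} (hx : x ∈ Set.Icc (0:ℝ) 1) :
    ConvexOn ℝ Set.univ (fun m => pasV p01 p11 β m (V m) x) :=
  (convexOn_id convex_univ).add
    ((hc.convexOn_value_subsidy hV (hc.T_mem hx)).smul hc.hβ.1.le)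

lemma convexOn_actV (hc : Channel p01 p11 ε β)
    {V : ℝ → ℝ → ℝ} (hV : ∀ m, IsValue p01 p11 ε β m (V m)) {x : ℝ} (hx : x ∈ Set.Icc (0:ℝ) 1) :
    ConvexOn ℝ Set.univ (fun m => actV p01 p11 ε β (V m) x) :=
  (convexOn_const _ convex_univ).add
    ((((hc.convexOn_value_subsidy hV hc.p11_mem).smul (hc.success_nonneg hx)).add
      ((hc.convexOn_value_subsidy hV (hc.Tφ_mem hx)).smul (hc.success_le_one hx))).smul
        hc.hβ.1.le)

/-- Strict preference for passivity persists when the subsidy grows. -/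
lemma adv_pos_of_le (hc : Channel p01 p11 ε β)
    {V : ℝ → ℝ → ℝ} (hV : ∀ m, IsValue p01 p11 ε β m (V m))
    (hderiv : ∀ m0 : ℝ, ∀ ω ∈ Set.Icc (0:ℝ) 1,
      actV p01 p11 ε β (V m0) ω ≤ pasV p01 p11 β m0 (V m0) ω →
      derivWithin (fun m : ℝ => actV p01 p11 ε β (V m) ω) (Set.Ici m0) m0
        ≤ derivWithin (fun m : ℝ => pasV p01 p11 β m (V m) ω) (Set.Ici m0) m0)
    {m m' x : ℝ} (hx : x ∈ Set.Icc (0:ℝ) 1) (hm : m ≤ m')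
    (h : 0 < adv p01 p11 ε β m (V m) x) : 0 < adv p01 p11 ε β m' (V m') x := by
  have hd : ∀ {f : ℝ → ℝ}, ConvexOn ℝ Set.univ f → ∀ y,
      HasDerivWithinAt f (derivWithin f (Set.Ici y) y) (Set.Ici y) y := fun {f} hf y =>
    (hf.hasDerivWithinAt_rightDeriv_of_mem_interior
      (by simp : y ∈ interior Set.univ)).Ici_of_Ioi.differentiableWithinAt.hasDerivWithinAt
  have hden : 0 < m' - m + 1 := by linarith
  obtain ⟨η, hη, hlt⟩ : ∃ η > 0, η * (m' - m) < adv p01 p11 ε β m (V m) x := by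
    refine ⟨adv p01 p11 ε β m (V m) x / (m' - m + 1), div_pos h hden, ?_⟩
    rw [div_mul_eq_mul_div, div_lt_iff₀ hden]
    nlinarith
  have key := image_le_of_deriv_right_lt_deriv_boundary' (a := m) (b := m')
    (f := fun y => actV p01 p11 ε β (V y) x - pasV p01 p11 β y (V y) x)
    (f' := fun y => derivWithin (fun m : ℝ => actV p01 p11 ε β (V m) x) (Set.Ici y) y
      - derivWithin (fun m : ℝ => pasV p01 p11 β m (V m) x) (Set.Ici y) y)
    (B := fun y => -adv p01 p11 ε β m (V m) x + η * (y - m)) (B' := fun _ => η)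
    (by
      refine (hc.continuous_adv_subsidy hV hx).neg.continuousOn.congr fun y _ => ?_
      simp [adv])
    (fun y _ => (hd (hc.convexOn_actV hV hx) y).sub (hd (hc.convexOn_pasV hV hx) y))
    (by simp [adv])
    (by fun_prop)
    (fun y _ => by
      have := (((hasDerivAt_id y).sub_const m).const_mul η).const_add
        (-adv p01 p11 ε β m (V m) x)
      simpa using this.hasDerivWithinAt)
    (fun y hy hyB => by
      have : η * (y - m) ≤ η * (m' - m) := by
        have := hy.2
        gcongr
      have := hderiv y x hx (by linarith)
      linarith)
    (Set.right_mem_Icc.2 hm)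
  unfold adv at key hlt ⊢
  linarith

/-- A state that is passive at a subsidy under which its successor is passive forever stays
passive at larger subsidies. -/
lemma adv_nonneg_of_value_eq (hc : Channel p01 p11 ε β)
    {V : ℝ → ℝ → ℝ} (hV : ∀ m, IsValue p01 p11 ε β m (V m))
    {m m' x : ℝ} (hx : x ∈ Set.Icc (0:ℝ) 1) (hm : m ≤ m')
    (h : 0 ≤ adv p01 p11 ε β m (V m) x) (hv : V m (Tmap p01 p11 x) = m / (1 - β)) :
    0 ≤ adv p01 p11 ε β m' (V m') x := by
  have hβ := sub_pos.2 hc.hβ.2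
  have h1 := hc.le_value (hV m') (hc.T_mem hx)
  have h2 := hc.actV_le (f := V m') (g := V m) (M := (m' - m) / (1 - β)) (fun y hy => by
    linarith [hc.value_sub_le (hV m') (hV m) (sub_nonneg.2 hm) le_rfl y hy]) hx
  unfold adv pasV at *
  rw [hv] at h
  have h3 := mul_le_mul_of_nonneg_left h1 hc.hβ.1.le
  have h4 : β * (m' / (1 - β)) = β * (m / (1 - β)) + β * ((m' - m) / (1 - β)) := by ring
  linarith

end Channel

/-! ### Monotonicity of the passive set -/

lemma eventually_adv_pos {D : ℝ → ℝ} {b k : ℝ} (hb : 0 < b) (hk : 0 < k) (hD : 0 ≤ D b)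
    (h : ∀ᶠ a in nhdsWithin b (Set.Iio b), (b - a) * k ≤ b * D a - a * D b) :
    ∀ᶠ a in nhdsWithin b (Set.Iio b), 0 < D a := by
  filter_upwards [h, Ioo_mem_nhdsLT hb] with a h1 h2
  have h3 := mul_pos (sub_pos.2 h2.2) hk
  have h4 := mul_nonneg h2.1.le hD
  exact pos_of_mul_pos_right (by linarith : 0 < b * D a) hb.le

/-- A continuous function that is positive to the left of each of its nonnegative values stays
negative once it is negative. -/
lemma neg_of_neg_left {D : ℝ → ℝ} {o u : ℝ} (hD : ContinuousOn D (Set.Icc o u))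
    (h : ∀ b ∈ Set.Ioc o u, 0 ≤ D b → ∀ᶠ a in nhdsWithin b (Set.Iio b), 0 < D a)
    (ho : D o < 0) : ∀ y ∈ Set.Icc o u, D y < 0 := by
  intro y hy
  by_contra hDy
  have hK : IsCompact (Set.Icc o u ∩ D ⁻¹' Set.Ici 0) :=
    isCompact_Icc.of_isClosed_subset
      (hD.preimage_isClosed_of_isClosed isClosed_Icc isClosed_Ici) Set.inter_subset_left
  obtain ⟨z, ⟨hz, hDz⟩, hmin⟩ := hK.exists_isLeast ⟨y, hy, not_lt.1 hDy⟩
  have hoz : o < z := by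
    refine lt_of_le_of_ne hz.1 ?_
    rintro rfl
    exact absurd hDz (not_le.2 ho)
  have := (h z ⟨hoz, hz.2⟩ hDz).and (Ioo_mem_nhdsLT hoz)
  obtain ⟨a, ha, hao⟩ := this.exists
  exact absurd (hmin ⟨⟨hao.1.le, hao.2.le.trans hz.2⟩, ha.le⟩) (not_le.2 hao.2)

namespace Channel

variable {p01 p11 ε β : ℝ}

lemma continuousAt_Tφ (hc : Channel p01 p11 ε β) {x : ℝ} (hx : x ∈ Set.Icc (0:ℝ) 1) :
    ContinuousAt (fun a => Tmap p01 p11 (phi ε a)) x :=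
  continuous_Tmap.continuousAt.comp (continuousAt_phi hc.hε hx)

lemma adv_nonneg_of_eventually (hc : Channel p01 p11 ε β)
    {V : ℝ → ℝ → ℝ} (hV : ∀ m, IsValue p01 p11 ε β m (V m))
    (hderiv : ∀ m0 : ℝ, ∀ ω ∈ Set.Icc (0:ℝ) 1,
      actV p01 p11 ε β (V m0) ω ≤ pasV p01 p11 β m0 (V m0) ω →
      derivWithin (fun m : ℝ => actV p01 p11 ε β (V m) ω) (Set.Ici m0) m0
        ≤ derivWithin (fun m : ℝ => pasV p01 p11 β m (V m) ω) (Set.Ici m0) m0)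
    {m m' b : ℝ} (hb : b ∈ Set.Ioc (0:ℝ) 1) (hm : m ≤ m')
    (h : ∀ᶠ a in nhdsWithin b (Set.Iio b), 0 < adv p01 p11 ε β m (V m) a) :
    0 ≤ adv p01 p11 ε β m' (V m') b := by
  have hI : ∀ᶠ a in nhdsWithin b (Set.Iio b), a ∈ Set.Icc (0:ℝ) 1 := by
    filter_upwards [Ioo_mem_nhdsLT hb.1] with a ha using ⟨ha.1.le, ha.2.le.trans hb.2⟩
  have hlim := (hc.continuousOn_adv hV m' b ⟨hb.1.le, hb.2⟩).mono_left
    (nhdsWithin_le_iff.2 hI)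
  refine ge_of_tendsto hlim ?_
  filter_upwards [h, hI] with a h1 h2 using (hc.adv_pos_of_le hV hderiv h2 hm h1).le

lemma eventually_adv_pos_of_pos (hc : Channel p01 p11 ε β)
    {V : ℝ → ℝ → ℝ} (hV : ∀ m, IsValue p01 p11 ε β m (V m)) (hp : p01 ≤ p11) {m b : ℝ} (hm : 0 < m)
    (hb : b ∈ Set.Ioc (0:ℝ) 1) (h : 0 ≤ adv p01 p11 ε β m (V m) b) :
    ∀ᶠ a in nhdsWithin b (Set.Iio b), 0 < adv p01 p11 ε β m (V m) a := by
  have hbI : b ∈ Set.Icc (0:ℝ) 1 := ⟨hb.1.le, hb.2⟩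
  refine eventually_adv_pos hb.1 (mul_pos hm (sub_pos.2 hc.hβ.2)) h ?_
  have := nhdsWithin_le_nhds (s := Set.Iio b) ((hc.continuousAt_Tφ hbI).eventually
    (lt_mem_nhds (phi_Tmap_lt hc.hp01 hc.hp11 hc.hε hbI)))
  filter_upwards [this, Ioo_mem_nhdsLT hb.1] with a h1 h2
  exact hc.adv_cross_of_pos hV hp hm.le ⟨h2.1.le, h2.2.le.trans hb.2⟩ hbI h2.2.le h1.le

lemma pos_of_adv_nonneg (hc : Channel p01 p11 ε β)
    {V : ℝ → ℝ → ℝ} (hV : ∀ m, IsValue p01 p11 ε β m (V m)) {m x : ℝ} (hx : x ∈ Set.Ioc (0:ℝ) 1)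
    (h : 0 ≤ adv p01 p11 ε β m (V m) x) : 0 < m := by
  linarith [hc.adv_le hV m ⟨hx.1.le, hx.2⟩, mul_pos (sub_pos.2 hc.hε.2) hx.1]

/-- If a state and its successor are passive under negatively correlated transitions, then both
are passive forever. -/
lemma value_eq_of_adv_nonneg (hc : Channel p01 p11 ε β)
    {V : ℝ → ℝ → ℝ} (hV : ∀ m, IsValue p01 p11 ε β m (V m))
    (hp : p11 ≤ p01) {m x : ℝ} (hx : x ∈ Set.Icc (0:ℝ) 1)
    (h : 0 ≤ adv p01 p11 ε β m (V m) x)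
    (h' : 0 ≤ adv p01 p11 ε β m (V m) (Tmap p01 p11 x)) :
    V m x = m / (1 - β) ∧ V m (Tmap p01 p11 x) = m / (1 - β) := by
  have hβ := sub_pos.2 hc.hβ.2
  have hTx := hc.T_mem hx
  have h0 := value_eq_pasV (hV m) hx h
  have h1 := value_eq_pasV (hV m) hTx h'
  have h2 := hc.le_value (hV m) (hc.T_mem hTx)
  have hδ : 0 ≤ p01 - p11 := sub_nonneg.2 hp
  have hδ' : 0 ≤ 1 - (p01 - p11) := by linarith [hc.hp01.2, hc.hp11.1]
  have h3 := (hc.convexOn_value hV m).2 hx hTx hδ hδ' (by ring)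
  have e : (p01 - p11) • x + (1 - (p01 - p11)) • Tmap p01 p11 x
      = Tmap p01 p11 (Tmap p01 p11 x) := by
    simp only [smul_eq_mul, Tmap]; ring
  rw [e] at h3
  simp only [smul_eq_mul] at h3
  unfold pasV at h0 h1
  have hc0 : m / (1 - β) = m + β * (m / (1 - β)) := by field_simp; ring
  generalize m / (1 - β) = c at *
  generalize V m (Tmap p01 p11 (Tmap p01 p11 x)) = y at *
  have hy : y ≤ c := by
    have hcoef : (p01 - p11) * β ^ 2 + (1 - (p01 - p11)) * β < 1 := by
      nlinarith [hc.hβ.1, hc.hβ.2, hc.hp01.2, hc.hp11.1, mul_pos hc.hβ.1 hβ]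
    have : y - c ≤ ((p01 - p11) * β ^ 2 + (1 - (p01 - p11)) * β) * (y - c) := by
      rw [h0, h1] at h3
      nlinarith
    nlinarith
  have hyc : y = c := le_antisymm hy h2
  rw [hyc, ← hc0] at h1
  rw [h1, ← hc0] at h0
  exact ⟨h0, h1⟩

lemma adv_cross_of_forall_neg (hc : Channel p01 p11 ε β)
    {V : ℝ → ℝ → ℝ} (hV : ∀ m, IsValue p01 p11 ε β m (V m))
    (hp : p11 ≤ p01) {u : ℝ} (hu : Tmap p01 p11 u = u) {m : ℝ}
    (hu0 : u ∈ Set.Icc (0:ℝ) 1) (hm : 0 ≤ m)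
    (hact : ∀ μ ∈ Set.Icc 0 m, ∀ x ∈ Set.Icc u 1, adv p01 p11 ε β μ (V μ) x < 0)
    {a b : ℝ} (ha : a ∈ Set.Icc (0:ℝ) 1) (hb : b ∈ Set.Icc (0:ℝ) 1) (hab : a ≤ b)
    (hbu : b ≤ u)
    (h : phi ε (Tmap p01 p11 (phi ε (Tmap p01 p11 b)))
      ≤ Tmap p01 p11 (phi ε (Tmap p01 p11 (phi ε a)))) :
    (b - a) * (m * (1 - β)) ≤ b * adv p01 p11 ε β m (V m) a
      - a * adv p01 p11 ε β m (V m) b := by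
  have hcont := (hc.continuousOn_adv_prod hV).mono
    (Set.prod_mono (Set.subset_univ (Set.Icc 0 m)) (Set.Icc_subset_Icc_left hu0.1))
  obtain ⟨z, hz, hmax⟩ := (isCompact_Icc.prod isCompact_Icc).exists_isMaxOn
    ⟨(0, u), ⟨le_rfl, hm⟩, ⟨le_rfl, hu0.2⟩⟩ hcont
  refine hc.adv_cross_of_neg hV hp hu hu0.1 hm (neg_pos.2 (hact z.1 hz.1 z.2 hz.2))
    (fun μ hμ x hx => ?_) ha hb hab hbu h
  rw [neg_neg]
  have hmem : ((μ, x) : ℝ × ℝ) ∈ Set.Icc 0 m ×ˢ Set.Icc u 1 := ⟨hμ, hx⟩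
  exact hmax hmem

lemma eventually_adv_pos_of_neg (hc : Channel p01 p11 ε β)
    {V : ℝ → ℝ → ℝ} (hV : ∀ m, IsValue p01 p11 ε β m (V m))
    (hp : p11 ≤ p01) {u : ℝ} (hu : Tmap p01 p11 u = u) {m : ℝ}
    (hu0 : u ∈ Set.Icc (0:ℝ) 1) (hm : 0 < m)
    (hact : ∀ μ ∈ Set.Ico 0 m, ∀ x ∈ Set.Icc u 1, adv p01 p11 ε β μ (V μ) x < 0)
    {b : ℝ} (hb : b ∈ Set.Ioc 0 u) (h : 0 ≤ adv p01 p11 ε β m (V m) b) :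
    ∀ᶠ a in nhdsWithin b (Set.Iio b), 0 < adv p01 p11 ε β m (V m) a := by
  have hbI : b ∈ Set.Icc (0:ℝ) 1 := ⟨hb.1.le, hb.2.trans hu0.2⟩
  refine eventually_adv_pos hb.1 (mul_pos hm (sub_pos.2 hc.hβ.2)) h ?_
  have hcont : ContinuousAt (fun a => Tmap p01 p11 (phi ε (Tmap p01 p11 (phi ε a)))) b :=
    (hc.continuousAt_Tφ (hc.Tφ_mem hbI)).comp_of_eq (hc.continuousAt_Tφ hbI) rfl
  have := nhdsWithin_le_nhds (s := Set.Iio b) (hcont.eventually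
    (lt_mem_nhds (phi_Tmap_phi_Tmap_lt hc.hp01 hc.hp11 hc.hε hbI)))
  filter_upwards [this, Ioo_mem_nhdsLT hb.1] with a h1 h2
  have haI : a ∈ Set.Icc (0:ℝ) 1 := ⟨h2.1.le, h2.2.le.trans hbI.2⟩
  have hl : Continuous fun μ : ℝ => (b - a) * (μ * (1 - β)) := by fun_prop
  have hr : Continuous fun μ : ℝ => b * adv p01 p11 ε β μ (V μ) a
      - a * adv p01 p11 ε β μ (V μ) b :=
    ((hc.continuous_adv_subsidy hV haI).const_mul b).sub
      ((hc.continuous_adv_subsidy hV hbI).const_mul a)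
  refine le_of_tendsto_of_tendsto (hl.continuousWithinAt (s := Set.Iio m) (x := m))
    (hr.continuousWithinAt (s := Set.Iio m) (x := m)) ?_
  filter_upwards [Ioo_mem_nhdsLT hm] with μ hμ
  exact hc.adv_cross_of_forall_neg hV hp hu hu0 hμ.1.le
    (fun ν hν x hx => hact ν ⟨hν.1, hν.2.trans_lt hμ.2⟩ x hx) haI hbI h2.2.le hb.2 h1.le

/-- On a set closed under failed observations on which activity is optimal, the value is
affine. -/
lemma exists_affine_value (hc : Channel p01 p11 ε β)
    {V : ℝ → ℝ → ℝ} (hV : ∀ m, IsValue p01 p11 ε β m (V m))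
    {m : ℝ} {J : Set ℝ} (hJ : J ⊆ Set.Icc (0:ℝ) 1)
    (hinv : ∀ x ∈ J, Tmap p01 p11 (phi ε x) ∈ J)
    (hact : ∀ x ∈ J, adv p01 p11 ε β m (V m) x ≤ 0) :
    ∃ α κ : ℝ, ∀ x ∈ J, V m x = α * x + κ := by
  have hβ := sub_pos.2 hc.hβ.2
  have h0 : 0 < 1 - β * (ε * p11 - p01) + β * (1 - ε) * (β * p01 / (1 - β)) := by
    have h1 : 0 < β * (1 - ε) * (β * p01 / (1 - β)) :=
      mul_pos (mul_pos hc.hβ.1 (sub_pos.2 hc.hε.2)) (div_pos (mul_pos hc.hβ.1 hc.hp01.1) hβ)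
    have h2 : β * (ε * p11) < 1 := by
      have h3 : ε * p11 < 1 := by nlinarith [hc.hε.1, hc.hε.2, hc.hp11.1, hc.hp11.2]
      nlinarith [hc.hβ.1, hc.hβ.2, mul_pos hc.hε.1 hc.hp11.1]
    nlinarith [mul_pos hc.hβ.1 hc.hp01.1]
  obtain ⟨α, hα⟩ : ∃ α, α * (1 - β * (ε * p11 - p01) + β * (1 - ε) * (β * p01 / (1 - β)))
      = (1 - ε) * (1 + β * V m p11) := ⟨_, div_mul_cancel₀ _ h0.ne'⟩
  obtain ⟨κ, hκ⟩ : ∃ κ, κ = α * (β * p01 / (1 - β)) := ⟨_, rfl⟩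
  have hκ' : κ * (1 - β) = α * (β * p01) := by rw [hκ]; field_simp
  refine ⟨α, κ, ?_⟩
  obtain ⟨C, hC⟩ := (hV m).bdd
  have := le_of_contraction (s := J) (g := fun x => |V m x - (α * x + κ)|) (β := β) (d := 0)
    (C := C + (|α| + |κ|)) hc.hβ.2 (fun x hx => by
      have h1 := hC x (hJ hx)
      have h2 : |α * x + κ| ≤ |α| + |κ| := by
        refine (abs_add_le _ _).trans ?_
        rw [abs_mul, abs_of_nonneg (hJ hx).1]
        nlinarith [abs_nonneg α, (hJ hx).2]
      exact (abs_sub _ _).trans (add_le_add h1 h2)) (by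
      intro M hM x hx
      have hxI := hJ hx
      have hM0 : 0 ≤ M := (abs_nonneg _).trans (hM x hx)
      have h1 : V m x - (α * x + κ) = β * ((1 - (1 - ε) * x)
          * (V m (Tmap p01 p11 (phi ε x)) - (α * Tmap p01 p11 (phi ε x) + κ))) := by
        have h2 := Tmap_eq_average (p01 := p01) (p11 := p11) hc.hε hxI
        have h3 : Tmap p01 p11 x = x * p11 + (1 - x) * p01 := rfl
        have h4 : β * (1 - ε) * (β * p01 / (1 - β)) * α = β * (1 - ε) * κ := by rw [hκ]; ring
        rw [value_eq_actV (hV m) hxI (hact x hx), actV]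
        linear_combination (-x) * hα + x * h4 - hκ' - β * α * h2 + β * α * h3
      have h5 := hM _ (hinv x hx)
      rw [add_zero, h1, abs_mul, abs_mul, abs_of_nonneg hc.hβ.1.le,
        abs_of_nonneg (hc.success_le_one hxI)]
      refine mul_le_mul_of_nonneg_left ?_ hc.hβ.1.le
      calc _ ≤ 1 * M := mul_le_mul (by linarith [hc.success_nonneg hxI]) h5 (abs_nonneg _)
            zero_le_one
        _ = M := one_mul M)
  intro x hx
  have h := this x hx
  rw [zero_div] at h
  exact sub_eq_zero.1 (abs_nonpos_iff.1 h)

/-- At the first subsidy at which some belief above the stationary one is passive, the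
stationary belief is passive. -/
lemma adv_stationary_nonneg (hc : Channel p01 p11 ε β)
    {V : ℝ → ℝ → ℝ} (hV : ∀ m, IsValue p01 p11 ε β m (V m))
    (hp : p11 < p01) {u : ℝ} (hu : Tmap p01 p11 u = u) {m : ℝ}
    (hu0 : u ∈ Set.Ioo (0:ℝ) 1) (hm : 0 < m)
    (hact : ∀ μ ∈ Set.Ico 0 m, ∀ x ∈ Set.Icc u 1, adv p01 p11 ε β μ (V μ) x < 0)
    {b : ℝ} (hb : b ∈ Set.Icc u 1) (hDb : 0 ≤ adv p01 p11 ε β m (V m) b) :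
    0 ≤ adv p01 p11 ε β m (V m) u := by
  by_contra hDu
  rw [not_le] at hDu
  have huI := Set.Ioo_subset_Icc_self hu0
  have hbI : b ∈ Set.Icc (0:ℝ) 1 := ⟨hu0.1.le.trans hb.1, hb.2⟩
  have T_anti : ∀ {x y : ℝ}, x ≤ y → Tmap p01 p11 y ≤ Tmap p01 p11 x :=
    Tmap_le_Tmap_of_neg hp.le
  have T_above : ∀ {x : ℝ}, x ≤ u → u ≤ Tmap p01 p11 x := fun h => by
    have := T_anti h; rwa [hu] at this
  have T_below : ∀ {x : ℝ}, u ≤ x → Tmap p01 p11 x ≤ u := fun h => by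
    have := T_anti h; rwa [hu] at this
  have hub : u < b := by
    refine lt_of_le_of_ne hb.1 ?_
    rintro rfl
    exact absurd hDb (not_le.2 hDu)
  have hnonpos : ∀ x ∈ Set.Icc u 1, adv p01 p11 ε β m (V m) x ≤ 0 := by
    intro x hx
    have hxI : x ∈ Set.Icc (0:ℝ) 1 := ⟨hu0.1.le.trans hx.1, hx.2⟩
    refine le_of_tendsto ((hc.continuous_adv_subsidy hV hxI).continuousWithinAt
      (s := Set.Iio m) (x := m)) ?_
    filter_upwards [Ioo_mem_nhdsLT hm] with μ hμ using (hact μ ⟨hμ.1.le, hμ.2⟩ x hx).le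
  have hu' : u * (1 - (p11 - p01)) = p01 := by unfold Tmap at hu; linarith
  have hDo : adv p01 p11 ε β m (V m) (Tmap p01 p11 b) < 0 := by
    by_contra hDo
    obtain ⟨h1, h2⟩ := hc.value_eq_of_adv_nonneg hV hp.le hbI hDb (not_lt.1 hDo)
    have hden : 0 < 1 + (p01 - p11) := by linarith
    have h3 := (hc.convexOn_value hV m).2 hbI (hc.T_mem hbI)
      (div_nonneg (sub_pos.2 hp).le hden.le) (div_nonneg zero_le_one hden.le)
      (by rw [← add_div, add_comm, div_self hden.ne'])
    have e : ((p01 - p11) / (1 + (p01 - p11))) • b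
        + (1 / (1 + (p01 - p11))) • Tmap p01 p11 b = u := by
      simp only [smul_eq_mul, Tmap]
      field_simp
      linarith
    rw [e, h1, h2] at h3
    have h4 : ((p01 - p11) / (1 + (p01 - p11))) • (m / (1 - β))
        + (1 / (1 + (p01 - p11))) • (m / (1 - β)) = m / (1 - β) := by
      simp only [smul_eq_mul]
      rw [← add_mul, ← add_div, add_comm (p01 - p11), div_self hden.ne', one_mul]
    rw [h4] at h3
    have h5 := value_eq_actV (hV m) huI hDu.le
    have h6 : pasV p01 p11 β m (V m) u < actV p01 p11 ε β (V m) u := sub_neg.1 hDu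
    have hβ := sub_pos.2 hc.hβ.2
    rw [← h5, pasV, hu] at h6
    rw [le_div_iff₀ hβ] at h3
    linarith
  have ho : Tmap p01 p11 b ∈ Set.Icc (0:ℝ) 1 := hc.T_mem hbI
  have hou : Tmap p01 p11 b ≤ u := T_below hb.1
  generalize hob : Tmap p01 p11 b = o at *
  have hneg : ∀ x ∈ Set.Icc o 1, adv p01 p11 ε β m (V m) x ≤ 0 := by
    intro x hx
    rcases le_total x u with hxu | hxu
    · refine (neg_of_neg_left ((hc.continuousOn_adv hV m).mono
        (Set.Icc_subset_Icc ho.1 huI.2)) (fun y hy hDy => ?_) hDo x ⟨hx.1, hxu⟩).le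
      exact hc.eventually_adv_pos_of_neg hV hp.le hu huI hm hact
        ⟨ho.1.trans_lt hy.1, hy.2⟩ hDy
    · exact hnonpos x ⟨hxu, hx.2⟩
  have hTTo : o ≤ Tmap p01 p11 (Tmap p01 p11 o) := by
    have : Tmap p01 p11 (Tmap p01 p11 o) - o
        = (1 - (p11 - p01)) * (1 - (p01 - p11)) * (u - o) := by
      simp only [Tmap]
      linear_combination (-(1 - (p01 - p11))) * hu'
    have h2 : (0:ℝ) ≤ (1 - (p11 - p01)) * (1 - (p01 - p11)) * (u - o) :=
      mul_nonneg (mul_nonneg (by linarith) (by linarith [hc.hp01.2, hc.hp11.1]))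
        (sub_nonneg.2 hou)
    linarith
  obtain ⟨α, κ, hℓ⟩ := hc.exists_affine_value hV (m := m)
    (J := {x | x ∈ Set.Icc o 1 ∧ o ≤ Tmap p01 p11 (phi ε x)})
    (fun x hx => ⟨ho.1.trans hx.1.1, hx.1.2⟩)
    (fun x hx => by
      have hxI : x ∈ Set.Icc (0:ℝ) 1 := ⟨ho.1.trans hx.1.1, hx.1.2⟩
      refine ⟨⟨hx.2, (hc.Tφ_mem hxI).2⟩, hTTo.trans (T_anti ?_)⟩
      exact (phi_le_phi hc.hε (hc.Tφ_mem hxI) (hc.Tφ_mem ho)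
        (T_anti (phi_le_phi hc.hε ho hxI hx.1.1))).trans
          (phi_Tmap_phi_le hc.hp01 hc.hp11 hc.hε ho))
    (fun x hx => hneg x hx.1)
  have hlin : ∀ x ∈ Set.Icc u b, adv p01 p11 ε β m (V m) x
      = m - (1 - ε) * (1 + β * (V m p11 - (α * p11 + κ))) * x := by
    intro x hx
    have hxI : x ∈ Set.Icc (0:ℝ) 1 := ⟨hu0.1.le.trans hx.1, hx.2.trans hbI.2⟩
    have hTx : o ≤ Tmap p01 p11 x := by rw [← hob]; exact T_anti hx.2
    have h1 := hℓ (Tmap p01 p11 x) ⟨⟨hTx, (hc.T_mem hxI).2⟩, hou.trans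
      (T_above ((phi_le_self hc.hε (hc.T_mem hxI)).trans (T_below hx.1)))⟩
    have h2 := hℓ (Tmap p01 p11 (phi ε x)) ⟨⟨hTx.trans (T_anti (phi_le_self hc.hε hxI)),
      (hc.Tφ_mem hxI).2⟩, hou.trans (T_above
        ((phi_Tmap_phi_le hc.hp01 hc.hp11 hc.hε hxI).trans (T_below hx.1)))⟩
    have h3 := Tmap_eq_average (p01 := p01) (p11 := p11) hc.hε hxI
    unfold adv pasV actV
    rw [h1, h2]
    linear_combination β * α * h3
  have h1 := hlin b ⟨hb.1, le_rfl⟩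
  have h2 := hlin u ⟨le_rfl, hb.1⟩
  rw [h2] at hDu
  have h3 := hnonpos b hb
  rw [h1] at hDb h3
  generalize (1 - ε) * (1 + β * (V m p11 - (α * p11 + κ))) = K at *
  nlinarith [mul_pos hm (sub_pos.2 hub), hu0.1]

end Channel

/-! ### Indexability -/

namespace Channel

variable {p01 p11 ε β : ℝ}

/-- The least subsidy for which some belief at or above the stationary belief is passive. -/
lemma exists_first_passive (hc : Channel p01 p11 ε β)
    {V : ℝ → ℝ → ℝ} (hV : ∀ m, IsValue p01 p11 ε β m (V m)) {u : ℝ} (hu0 : u ∈ Set.Ioo (0:ℝ) 1) :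
    ∃ m, 0 < m ∧ (∀ μ ∈ Set.Ico 0 m, ∀ x ∈ Set.Icc u 1, adv p01 p11 ε β μ (V μ) x < 0) ∧
      ∃ b ∈ Set.Icc u 1, 0 ≤ adv p01 p11 ε β m (V m) b := by
  have hcont := (hc.continuousOn_adv_prod hV).mono
    (Set.prod_mono (Set.subset_univ (Set.Icc 0 (1 - ε))) (Set.Icc_subset_Icc_left hu0.1.le))
  have hε : 0 ≤ 1 - ε := (sub_pos.2 hc.hε.2).le
  have hK := (isCompact_Icc.prod isCompact_Icc).of_isClosed_subset
    (hcont.preimage_isClosed_of_isClosed (isClosed_Icc.prod isClosed_Icc) isClosed_Ici)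
    (Set.inter_subset_left (t := _ ⁻¹' Set.Ici 0))
  obtain ⟨z, ⟨hz, hDz⟩, hmin⟩ := hK.exists_isMinOn
    ⟨(1 - ε, u), ⟨⟨hε, le_rfl⟩, ⟨le_rfl, hu0.2.le⟩⟩,
      hc.adv_nonneg_of_le (hV _) le_rfl (Set.Ioo_subset_Icc_self hu0)⟩ continuous_fst.continuousOn
  refine ⟨z.1, hc.pos_of_adv_nonneg hV ⟨hu0.1.trans_le hz.2.1, hz.2.2⟩ hDz,
    fun μ hμ x hx => ?_, z.2, hz.2, hDz⟩
  by_contra h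
  have hmem : ((μ, x) : ℝ × ℝ) ∈ Set.Icc 0 (1 - ε) ×ˢ Set.Icc u 1 :=
    ⟨⟨hμ.1, hμ.2.le.trans hz.1.2⟩, hx⟩
  exact absurd (hmin ⟨hmem, not_lt.1 h⟩) (not_le.2 hμ.2)

lemma adv_nonneg_mono_of_pos (hc : Channel p01 p11 ε β)
    {V : ℝ → ℝ → ℝ} (hV : ∀ m, IsValue p01 p11 ε β m (V m))
    (hderiv : ∀ m0 : ℝ, ∀ ω ∈ Set.Icc (0:ℝ) 1,
      actV p01 p11 ε β (V m0) ω ≤ pasV p01 p11 β m0 (V m0) ω →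
      derivWithin (fun m : ℝ => actV p01 p11 ε β (V m) ω) (Set.Ici m0) m0
        ≤ derivWithin (fun m : ℝ => pasV p01 p11 β m (V m) ω) (Set.Ici m0) m0)
    (hp : p01 ≤ p11) {m m' x : ℝ} (hm : m ≤ m')
    (hx : x ∈ Set.Ioc (0:ℝ) 1) (h : 0 ≤ adv p01 p11 ε β m (V m) x) :
    0 ≤ adv p01 p11 ε β m' (V m') x :=
  hc.adv_nonneg_of_eventually hV hderiv hx hm
    (hc.eventually_adv_pos_of_pos hV hp (hc.pos_of_adv_nonneg hV hx h) hx h)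

lemma adv_nonneg_mono_of_neg (hc : Channel p01 p11 ε β)
    {V : ℝ → ℝ → ℝ} (hV : ∀ m, IsValue p01 p11 ε β m (V m))
    (hderiv : ∀ m0 : ℝ, ∀ ω ∈ Set.Icc (0:ℝ) 1,
      actV p01 p11 ε β (V m0) ω ≤ pasV p01 p11 β m0 (V m0) ω →
      derivWithin (fun m : ℝ => actV p01 p11 ε β (V m) ω) (Set.Ici m0) m0
        ≤ derivWithin (fun m : ℝ => pasV p01 p11 β m (V m) ω) (Set.Ici m0) m0)
    (hp : p11 < p01) {m m' x : ℝ} (hm : m ≤ m')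
    (hx : x ∈ Set.Ioc (0:ℝ) 1) (h : 0 ≤ adv p01 p11 ε β m (V m) x) :
    0 ≤ adv p01 p11 ε β m' (V m') x := by
  have hm0 := hc.pos_of_adv_nonneg hV hx h
  have hxI : x ∈ Set.Icc (0:ℝ) 1 := ⟨hx.1.le, hx.2⟩
  have hden : 0 < 1 - (p11 - p01) := by linarith
  obtain ⟨u, hu'⟩ : ∃ u, u * (1 - (p11 - p01)) = p01 := ⟨_, div_mul_cancel₀ _ hden.ne'⟩
  have hu : Tmap p01 p11 u = u := by unfold Tmap; linarith
  have hu0 : u ∈ Set.Ioo (0:ℝ) 1 :=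
    ⟨pos_of_mul_pos_left (by rw [hu']; exact hc.hp01.1) hden.le, by
      nlinarith [hc.hp11.2]⟩
  have huI := Set.Ioo_subset_Icc_self hu0
  obtain ⟨m₂, hm₂, hact, b, hb, hDb⟩ := hc.exists_first_passive hV hu0
  rcases lt_or_ge m m₂ with hlt | hge
  · have hxu : x < u := by
      by_contra hxu
      exact absurd h (not_le.2 (hact m ⟨hm0.le, hlt⟩ x ⟨not_lt.1 hxu, hx.2⟩))
    exact hc.adv_nonneg_of_eventually hV hderiv hx hm
      (hc.eventually_adv_pos_of_neg hV hp.le hu huI hm0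
        (fun μ hμ => hact μ ⟨hμ.1, hμ.2.trans hlt⟩) ⟨hx.1, hxu.le⟩ h)
  · have hlow : ∀ μ, m₂ ≤ μ → ∀ y ∈ Set.Ioc 0 u, 0 ≤ adv p01 p11 ε β μ (V μ) y := by
      intro μ hμ y hy
      have hev : ∀ z ∈ Set.Ioc 0 u, 0 ≤ adv p01 p11 ε β m₂ (V m₂) z →
          ∀ᶠ a in nhdsWithin z (Set.Iio z), 0 < adv p01 p11 ε β m₂ (V m₂) a := fun z hz hDz =>
        hc.eventually_adv_pos_of_neg hV hp.le hu huI hm₂ hact hz hDz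
      have hDy : 0 ≤ adv p01 p11 ε β m₂ (V m₂) y := by
        by_contra hDy
        have hDu := neg_of_neg_left ((hc.continuousOn_adv hV m₂).mono
          (Set.Icc_subset_Icc hy.1.le huI.2)) (fun z hz => hev z ⟨hy.1.trans hz.1, hz.2⟩)
          (not_le.1 hDy) u ⟨hy.2, le_rfl⟩
        exact absurd (hc.adv_stationary_nonneg hV hp hu hu0 hm₂ hact hb hDb) (not_le.2 hDu)
      exact hc.adv_nonneg_of_eventually hV hderiv ⟨hy.1, hy.2.trans huI.2⟩ hμ (hev y hy hDy)
    rcases le_total x u with hxu | hxu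
    · exact hlow m' (hge.trans hm) x ⟨hx.1, hxu⟩
    · have hTx : Tmap p01 p11 x ≤ u := by
        have := Tmap_le_Tmap_of_neg hp.le hxu
        rwa [hu] at this
      have hDT := hlow m hge _ ⟨(Tmap_mem_Ioo hc.hp01 hc.hp11 hxI).1, hTx⟩
      exact hc.adv_nonneg_of_value_eq hV hxI hm h
        (hc.value_eq_of_adv_nonneg hV hp.le hxI h hDT).2

lemma adv_nonneg_mono (hc : Channel p01 p11 ε β)
    {V : ℝ → ℝ → ℝ} (hV : ∀ m, IsValue p01 p11 ε β m (V m))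
    (hderiv : ∀ m0 : ℝ, ∀ ω ∈ Set.Icc (0:ℝ) 1,
      actV p01 p11 ε β (V m0) ω ≤ pasV p01 p11 β m0 (V m0) ω →
      derivWithin (fun m : ℝ => actV p01 p11 ε β (V m) ω) (Set.Ici m0) m0
        ≤ derivWithin (fun m : ℝ => pasV p01 p11 β m (V m) ω) (Set.Ici m0) m0)
    (hne : p01 ≠ p11) {m m' x : ℝ} (hm : m ≤ m')
    (hx : x ∈ Set.Icc (0:ℝ) 1) (h : 0 ≤ adv p01 p11 ε β m (V m) x) :
    0 ≤ adv p01 p11 ε β m' (V m') x := by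
  rcases hx.1.eq_or_lt with rfl | hx0
  · rw [adv_zero] at h ⊢
    exact h.trans hm
  · rcases hne.lt_or_gt with hp | hp
    · exact hc.adv_nonneg_mono_of_pos hV hderiv hp.le hm ⟨hx0, hx.2⟩ h
    · exact hc.adv_nonneg_mono_of_neg hV hderiv hp hm ⟨hx0, hx.2⟩ h

end Channel

/-- Sufficient condition for indexability: if for every subsidy `m0` and every
belief state `ω` in the passive set `P(m0)` the right derivative (in `m`, at
`m0`) of the passive value is at least that of the active value, then the
passive set is nondecreasing in `m`, i.e. the single-armed bandit is indexable. -/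
theorem indexability_of_right_deriv_order (p01 p11 ε β : ℝ)
    (hp01 : p01 ∈ Set.Ioo (0:ℝ) 1) (hp11 : p11 ∈ Set.Ioo (0:ℝ) 1)
    (hne : p01 ≠ p11) (hε : ε ∈ Set.Ioo (0:ℝ) 1) (hβ : β ∈ Set.Ioo (0:ℝ) 1)
    (V : ℝ → ℝ → ℝ)
    (hVbdd : ∀ m : ℝ, ∃ C, ∀ ω ∈ Set.Icc (0:ℝ) 1, |V m ω| ≤ C)
    (hVfix : ∀ m : ℝ, ∀ ω ∈ Set.Icc (0:ℝ) 1, V m ω = Bop p01 p11 ε β m (V m) ω)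
    (hderiv : ∀ m0 : ℝ, ∀ ω ∈ Set.Icc (0:ℝ) 1,
      actV p01 p11 ε β (V m0) ω ≤ pasV p01 p11 β m0 (V m0) ω →
      derivWithin (fun m : ℝ => actV p01 p11 ε β (V m) ω) (Set.Ici m0) m0
        ≤ derivWithin (fun m : ℝ => pasV p01 p11 β m (V m) ω) (Set.Ici m0) m0) :
    ∀ m m' : ℝ, m ≤ m' → ∀ ω ∈ Set.Icc (0:ℝ) 1,
      actV p01 p11 ε β (V m) ω ≤ pasV p01 p11 β m (V m) ω →
      actV p01 p11 ε β (V m') ω ≤ pasV p01 p11 β m' (V m') ω := by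
  intro m m' hm ω hω h
  have hc : Channel p01 p11 ε β := ⟨hp01, hp11, hε, hβ⟩
  have hV : ∀ m, IsValue p01 p11 ε β m (V m) := fun m => ⟨hVbdd m, hVfix m⟩
  exact sub_nonneg.1 (hc.adv_nonneg_mono hV hderiv hne hm hω (sub_nonneg.2 h))
end

section
/- If β ≤ 1/2, then the single-armed restless bandit with subsidy is indexable: for all subsidies m ≤ m' and every ω ∈ [0,1], V_{β,m}(ω;u=1) ≤ V_{β,m}(ω;u=0) implies V_{β,m'}(ω;u=1) ≤ V_{β,m'}(ω;u=0); equivalently, the passive set P(m) is monotonically nondecreasing in m. -/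
open Set

lemma Tmap_mem_Icc {p01 p11 ω : ℝ} (hp01 : p01 ∈ Icc (0:ℝ) 1) (hp11 : p11 ∈ Icc (0:ℝ) 1)
    (hω : ω ∈ Icc (0:ℝ) 1) : Tmap p01 p11 ω ∈ Icc (0:ℝ) 1 :=
  convex_Icc 0 1 hp11 hp01 hω.1 (sub_nonneg.2 hω.2) (add_sub_cancel ω 1)

lemma phi_mem_Icc {ε ω : ℝ} (hε : 0 ≤ ε) (hω : ω ∈ Icc (0:ℝ) 1) :
    phi ε ω ∈ Icc (0:ℝ) 1 := by
  have hnum : 0 ≤ ε * ω := mul_nonneg hε hω.1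
  have hle : ε * ω ≤ ε * ω + 1 - ω := by linarith [hω.2]
  exact ⟨div_nonneg hnum (hnum.trans hle), div_le_one_of_le₀ hle (hnum.trans hle)⟩

/-- A uniform bound on `f - g` over `[0,1]` passes, scaled by `β`, to the active branches. -/
lemma actV_sub_le {p01 p11 ε β S : ℝ} {f g : ℝ → ℝ}
    (hp01 : p01 ∈ Icc (0:ℝ) 1) (hp11 : p11 ∈ Icc (0:ℝ) 1) (hε : ε ∈ Icc (0:ℝ) 1) (hβ : 0 ≤ β)
    (h : ∀ ω ∈ Icc (0:ℝ) 1, f ω - g ω ≤ S) {ω : ℝ} (hω : ω ∈ Icc (0:ℝ) 1) :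
    actV p01 p11 ε β f ω - actV p01 p11 ε β g ω ≤ β * S := by
  have ha : 0 ≤ (1 - ε) * ω := mul_nonneg (sub_nonneg.2 hε.2) hω.1
  have hb : 0 ≤ 1 - (1 - ε) * ω := by nlinarith [hω.1, hω.2, hε.1, hε.2]
  have h1 := mul_le_mul_of_nonneg_left (h p11 hp11) ha
  have h2 := mul_le_mul_of_nonneg_left
    (h _ (Tmap_mem_Icc hp01 hp11 (phi_mem_Icc hε.1 hω))) hb
  have h3 := mul_le_mul_of_nonneg_left (add_le_add h1 h2) hβ
  unfold actV
  linarith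

/-- A uniform bound on `f - g` over `[0,1]` passes to the Bellman operators with
possibly different subsidies. -/
lemma Bop_sub_le {p01 p11 ε β m m' S : ℝ} {f g : ℝ → ℝ}
    (hp01 : p01 ∈ Icc (0:ℝ) 1) (hp11 : p11 ∈ Icc (0:ℝ) 1) (hε : ε ∈ Icc (0:ℝ) 1) (hβ : 0 ≤ β)
    (h : ∀ ω ∈ Icc (0:ℝ) 1, f ω - g ω ≤ S) {ω : ℝ} (hω : ω ∈ Icc (0:ℝ) 1) :
    Bop p01 p11 ε β m' f ω - Bop p01 p11 ε β m g ω ≤ max 0 (m' - m) + β * S := by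
  have hact := actV_sub_le hp01 hp11 hε hβ h hω
  have hpas := mul_le_mul_of_nonneg_left (h _ (Tmap_mem_Icc hp01 hp11 hω)) hβ
  rw [sub_le_iff_le_add]
  refine max_le ?_ ?_
  · have hg : actV p01 p11 ε β g ω ≤ Bop p01 p11 ε β m g ω := le_max_left _ _
    linarith [le_max_left 0 (m' - m)]
  · have hm := le_max_right 0 (m' - m)
    have hg : pasV p01 p11 β m g ω ≤ Bop p01 p11 ε β m g ω := le_max_right _ _
    unfold pasV at hg ⊢
    linarith

lemma le_div_one_sub_of_contracting {α : Type*} {s : Set α} {f : α → ℝ} {β d C : ℝ} (hβ : β < 1)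
    (hbdd : ∀ x ∈ s, f x ≤ C)
    (hstep : ∀ S, (∀ x ∈ s, f x ≤ S) → ∀ x ∈ s, f x ≤ d + β * S) {x : α} (hx : x ∈ s) :
    f x ≤ d / (1 - β) := by
  have hbdd' : BddAbove (f '' s) := ⟨C, forall_mem_image.2 hbdd⟩
  have hle : ∀ y ∈ s, f y ≤ sSup (f '' s) := fun y hy => le_csSup hbdd' (mem_image_of_mem f hy)
  have hsup : sSup (f '' s) ≤ d + β * sSup (f '' s) :=
    csSup_le ⟨_, mem_image_of_mem f hx⟩ (forall_mem_image.2 (hstep _ hle))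
  refine (hle x hx).trans ((le_div_iff₀ (sub_pos.2 hβ)).2 ?_)
  linarith

/-- Lipschitz dependence of the value function on the subsidy, one-sided form. -/
lemma value_sub_le {p01 p11 ε β m m' : ℝ} {f g : ℝ → ℝ}
    (hp01 : p01 ∈ Icc (0:ℝ) 1) (hp11 : p11 ∈ Icc (0:ℝ) 1) (hε : ε ∈ Icc (0:ℝ) 1)
    (hβ : β ∈ Ico (0:ℝ) 1)
    (hf : ∃ C, ∀ ω ∈ Icc (0:ℝ) 1, |f ω| ≤ C) (hg : ∃ C, ∀ ω ∈ Icc (0:ℝ) 1, |g ω| ≤ C)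
    (hffix : ∀ ω ∈ Icc (0:ℝ) 1, f ω = Bop p01 p11 ε β m' f ω)
    (hgfix : ∀ ω ∈ Icc (0:ℝ) 1, g ω = Bop p01 p11 ε β m g ω)
    {ω : ℝ} (hω : ω ∈ Icc (0:ℝ) 1) :
    f ω - g ω ≤ max 0 (m' - m) / (1 - β) := by
  obtain ⟨C, hC⟩ := hf
  obtain ⟨D, hD⟩ := hg
  refine le_div_one_sub_of_contracting (f := fun ω => f ω - g ω) (C := C + D) hβ.2 ?_ ?_ hω
  · intro x hx
    linarith [(abs_le.1 (hC x hx)).2, (abs_le.1 (hD x hx)).1]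
  · intro S hS x hx
    simp only [hffix x hx, hgfix x hx]
    exact Bop_sub_le hp01 hp11 hε hβ.1 hS hx

/-- If `β ≤ 1/2`, the single-armed restless bandit with subsidy is indexable:
the passive set `P(m) = {ω ∈ [0,1] : V_{β,m}(ω;u=1) ≤ V_{β,m}(ω;u=0)}` is
monotonically nondecreasing in the subsidy `m`. -/
theorem indexable_of_beta_le_half (p01 p11 ε β : ℝ)
    (hp01 : p01 ∈ Set.Ioo (0:ℝ) 1) (hp11 : p11 ∈ Set.Ioo (0:ℝ) 1)
    (hne : p01 ≠ p11) (hε : ε ∈ Set.Ioo (0:ℝ) 1) (hβ : β ∈ Set.Ioo (0:ℝ) 1)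
    (hβhalf : β ≤ 1 / 2)
    (V : ℝ → ℝ → ℝ)
    (hVbdd : ∀ m : ℝ, ∃ C, ∀ ω ∈ Set.Icc (0:ℝ) 1, |V m ω| ≤ C)
    (hVfix : ∀ m : ℝ, ∀ ω ∈ Set.Icc (0:ℝ) 1, V m ω = Bop p01 p11 ε β m (V m) ω) :
    ∀ m m' : ℝ, m ≤ m' → ∀ ω ∈ Set.Icc (0:ℝ) 1,
      actV p01 p11 ε β (V m) ω ≤ pasV p01 p11 β m (V m) ω →
      actV p01 p11 ε β (V m') ω ≤ pasV p01 p11 β m' (V m') ω := by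
  intro m m' hm ω hω hle
  have hp01' := Set.Ioo_subset_Icc_self hp01
  have hp11' := Set.Ioo_subset_Icc_self hp11
  have hε' := Set.Ioo_subset_Icc_self hε
  have hβ' := Set.Ioo_subset_Ico_self hβ
  have hupper : ∀ x ∈ Set.Icc (0:ℝ) 1, V m' x - V m x ≤ (m' - m) / (1 - β) := fun x hx => by
    simpa [max_eq_right (sub_nonneg.2 hm)] using value_sub_le hp01' hp11' hε' hβ'
      (hVbdd m') (hVbdd m) (hVfix m') (hVfix m) hx
  have hlower : ∀ x ∈ Set.Icc (0:ℝ) 1, V m x - V m' x ≤ 0 := fun x hx => by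
    simpa [max_eq_left (sub_nonpos.2 hm)] using value_sub_le hp01' hp11' hε' hβ'
      (hVbdd m) (hVbdd m') (hVfix m) (hVfix m') hx
  have hact := actV_sub_le hp01' hp11' hε' hβ.1.le hupper hω
  have hpas := mul_le_mul_of_nonneg_left (hlower _ (Tmap_mem_Icc hp01' hp11' hω)) hβ.1.le
  have hgain : β * ((m' - m) / (1 - β)) ≤ m' - m := by
    rw [← mul_div_assoc, div_le_iff₀ (sub_pos.2 hβ.2), mul_comm]
    exact mul_le_mul_of_nonneg_left (by linarith) (sub_nonneg.2 hm)
  unfold pasV at hle ⊢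
  linarith
end
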